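/- arXiv:2510.22578 — 2 statements merged into one kernel-verified Lean document; each statement's English description precedes it below -/
import Mathlib

section
/- Let 𝔽 ∈ {ℝ, ℂ}, let k, m, n be positive integers with k ≤ n, let p ∈ (0,1], and let r > 0 and 0 < L ≤ U be real numbers such that δ := L − U·2^{1/p−1}·(2/r)^{1/p−1/2} > 0. Suppose A ∈ 𝔽^{m×n} satisfies the phaseless bi-Lipschitz condition with constants L, U on the set X := {z ∈ 𝔽^n : ‖z‖₀ ≤ (r+4)k}. Define C̃₂ := U·(2^{1/p−1}/r^{1/p−1/2} + 1)/δ, C̃₁ := (2+r)^{1−p/2}·C̃₂^p, and D̃₁ := (2+r)^{1−p/2}·(2/δ)^p. Then for every x ∈ 𝔽^n, every η ≥ 0, every e ∈ ℝ^m with ‖e‖₂ ≤ η, and every x♯ ∈ 𝔽^n satisfying both ‖|A x♯| − (|A x| + e)‖₂ ≤ η and ‖x♯‖_p^p ≤ ‖x‖_p^p (in particular, any minimizer of ‖z‖_p over {z ∈ 𝔽^n : ‖|Az| − (|Ax| + e)‖₂ ≤ η}), one has dist_p(x♯, x) ≤ 2^{1/p−1}·(2·C̃₁ + 2)^{1/p}·σ_k(x)_p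 + 2^{1/p−1}·D̃₁^{1/p}·k^{1/p−1/2}·η. -/
open MeasureTheory ProbabilityTheory Real Finset

/-- The `ℓ_q` (quasi-)norm `(∑ i, ‖x i‖^q)^{1/q}` of a vector with entries in `𝕜 ∈ {ℝ, ℂ}`. -/
noncomputable def lpNorm {ι : Type*} [Fintype ι] {𝕜 : Type*} [RCLike 𝕜] (q : ℝ) (x : ι → 𝕜) : ℝ :=
  (∑ i, ‖x i‖ ^ q) ^ (1 / q)

open Classical in
/-- The number of nonzero entries of a vector. -/
noncomputable def l0Norm {ι : Type*} [Fintype ι] {𝕜 : Type*} [RCLike 𝕜] (x : ι → 𝕜) : ℕ :=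
  (Finset.univ.filter fun i => x i ≠ 0).card

/-- The phase distance `dist_q(x,y) = inf_{|c|=1} ‖x - c • y‖_q`. -/
noncomputable def phaseDist {ι : Type*} [Fintype ι] {𝕜 : Type*} [RCLike 𝕜] (q : ℝ)
    (x y : ι → 𝕜) : ℝ :=
  sInf {d | ∃ c : 𝕜, ‖c‖ = 1 ∧ d = lpNorm q (fun i => x i - c * y i)}

/-- The best `k`-term approximation error `σ_k(x)_q = inf {‖x - z‖_q : ‖z‖₀ ≤ k}`. -/
noncomputable def sigmaK {ι : Type*} [Fintype ι] {𝕜 : Type*} [RCLike 𝕜] (k : ℕ) (q : ℝ)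
    (x : ι → 𝕜) : ℝ :=
  sInf {d | ∃ z : ι → 𝕜, l0Norm z ≤ k ∧ d = lpNorm q (fun i => x i - z i)}

/-- The entrywise modulus `|Ax|` of the matrix-vector product `Ax`. -/
noncomputable def absMv {m n : ℕ} {𝕜 : Type*} [RCLike 𝕜] (A : Fin m → Fin n → 𝕜)
    (x : Fin n → 𝕜) : Fin m → ℝ :=
  fun i => ‖∑ j, A i j * x j‖

/-- `A` satisfies the phaseless bi-Lipschitz condition on `X` with constants `L, U`:
`L·dist(x,y) ≤ ‖|Ax| - |Ay|‖₂ ≤ U·dist(x,y)` for all `x, y ∈ X`. -/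
def PhaselessBiLip {m n : ℕ} {𝕜 : Type*} [RCLike 𝕜] (A : Fin m → Fin n → 𝕜)
    (X : Set (Fin n → 𝕜)) (L U : ℝ) : Prop :=
  ∀ x ∈ X, ∀ y ∈ X,
    L * phaseDist 2 x y ≤ lpNorm 2 (fun i => absMv A x i - absMv A y i) ∧
    lpNorm 2 (fun i => absMv A x i - absMv A y i) ≤ U * phaseDist 2 x y

section Auxiliary

theorem add_rpow_one_div_le {p : ℝ} (hp0 : 0 < p) (hp1 : p ≤ 1) {a b : ℝ} (ha : 0 ≤ a)
    (hb : 0 ≤ b) :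
    (a + b) ^ (1 / p) ≤ 2 ^ (1 / p - 1) * (a ^ (1 / p) + b ^ (1 / p)) := by
  lift a to NNReal using ha
  lift b to NNReal using hb
  exact_mod_cast NNReal.rpow_add_le_mul_rpow_add_rpow a b ((one_le_div hp0).2 hp1)

variable {ι : Type*} [Fintype ι] {𝕜 : Type*} [RCLike 𝕜]

theorem lpNorm_nonneg' (q : ℝ) (x : ι → 𝕜) : 0 ≤ _root_.lpNorm q x := by
  unfold _root_.lpNorm; positivity

theorem lpNorm_rpow_eq_sum {q : ℝ} (hq : 0 < q) (x : ι → 𝕜) :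
    _root_.lpNorm q x ^ q = ∑ i, ‖x i‖ ^ q := by
  unfold _root_.lpNorm
  rw [← Real.rpow_mul (by positivity), one_div_mul_cancel hq.ne', Real.rpow_one]

theorem lpNorm_le_lpNorm_of_norm_le {κ : Type*} [RCLike κ] {q : ℝ} (hq : 0 < q) {x : ι → 𝕜}
    {y : ι → κ} (h : ∀ i, ‖x i‖ ≤ ‖y i‖) : _root_.lpNorm q x ≤ _root_.lpNorm q y := by
  unfold _root_.lpNorm
  gcongr with i
  exact h i

theorem lpNorm_two_eq_norm (x : ι → 𝕜) : _root_.lpNorm 2 x = ‖WithLp.toLp 2 x‖ := by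
  rw [EuclideanSpace.norm_eq, Real.sqrt_eq_rpow]
  simp [_root_.lpNorm]

theorem lpNorm_two_add_le (x y : ι → 𝕜) :
    _root_.lpNorm 2 (x + y) ≤ _root_.lpNorm 2 x + _root_.lpNorm 2 y := by
  simp only [lpNorm_two_eq_norm, WithLp.toLp_add]
  exact norm_add_le _ _

theorem l0Norm_le_card {x : ι → 𝕜} (S : Finset ι) (h : ∀ i, x i ≠ 0 → i ∈ S) :
    l0Norm x ≤ #S := by
  unfold l0Norm
  exact Finset.card_le_card fun i hi => h i (by simpa using hi)

theorem phaseDist_le {q : ℝ} (x y : ι → 𝕜) {c : 𝕜} (hc : ‖c‖ = 1) :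
    phaseDist q x y ≤ _root_.lpNorm q (fun i => x i - c * y i) := by
  refine csInf_le ⟨0, ?_⟩ ⟨c, hc, rfl⟩
  rintro _ ⟨c, -, rfl⟩
  exact lpNorm_nonneg' _ _

theorem exists_phaseDist_eq {q : ℝ} (hq : 0 < q) (x y : ι → 𝕜) :
    ∃ c : 𝕜, ‖c‖ = 1 ∧ phaseDist q x y = _root_.lpNorm q (fun i => x i - c * y i) := by
  have hcont : Continuous fun c : 𝕜 => _root_.lpNorm q (fun i => x i - c * y i) := by
    unfold _root_.lpNorm
    refine Continuous.rpow_const (continuous_finsetSum _ fun i _ => ?_)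
      fun _ => Or.inr (by positivity)
    exact Continuous.rpow_const (by fun_prop) fun _ => Or.inr hq.le
  obtain ⟨c, hc, hmin⟩ := (isCompact_sphere (0 : 𝕜) 1).exists_isMinOn
    ⟨1, by simp⟩ hcont.continuousOn
  have hc1 : ‖c‖ = 1 := by simpa using hc
  refine ⟨c, hc1, (phaseDist_le x y hc1).antisymm (le_csInf ⟨_, c, hc1, rfl⟩ ?_)⟩
  rintro _ ⟨d, hd, rfl⟩
  exact hmin (by simpa using hd)

theorem norm_sub_rpow_le {p : ℝ} (hp0 : 0 < p) (hp1 : p ≤ 1) (a b : 𝕜) :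
    ‖a - b‖ ^ p ≤ ‖a‖ ^ p + ‖b‖ ^ p :=
  (Real.rpow_le_rpow (norm_nonneg _) (norm_sub_le a b) hp0.le).trans
    (Real.rpow_add_le_add_rpow (norm_nonneg _) (norm_nonneg _) hp0.le hp1)

/-- The restriction of a vector to a set of coordinates, extended by zero. -/
noncomputable def coordRestrict [DecidableEq ι] (S : Finset ι) (x : ι → 𝕜) : ι → 𝕜 :=
  fun i => if i ∈ S then x i else 0

variable [DecidableEq ι]

theorem coordRestrict_add_compl (S : Finset ι) (x : ι → 𝕜) :
    coordRestrict S x + coordRestrict Sᶜ x = x := by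
  ext i
  by_cases h : i ∈ S <;> simp [coordRestrict, h]

theorem l0Norm_coordRestrict_le (S : Finset ι) (x : ι → 𝕜) :
    l0Norm (coordRestrict S x) ≤ #S :=
  l0Norm_le_card S fun i hi => by
    by_contra h
    exact hi (by simp [coordRestrict, h])

theorem sum_norm_coordRestrict_rpow {q : ℝ} (hq : 0 < q) (S : Finset ι) (x : ι → 𝕜) :
    ∑ i, ‖coordRestrict S x i‖ ^ q = ∑ i ∈ S, ‖x i‖ ^ q := by
  have h : ∀ i, ‖coordRestrict S x i‖ ^ q = if i ∈ S then ‖x i‖ ^ q else 0 := fun i => by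
    by_cases hi : i ∈ S <;> simp [coordRestrict, hi, Real.zero_rpow hq.ne']
  simp [h]

/-- There are `t` coordinates carrying the largest values of `f`. -/
theorem exists_card_eq_forall_le (f : ι → ℝ) (t : ℕ) (ht : t ≤ Fintype.card ι) :
    ∃ T : Finset ι, #T = t ∧ ∀ i ∈ T, ∀ j ∉ T, f j ≤ f i := by
  induction t with
  | zero => exact ⟨∅, by simp⟩
  | succ t ih =>
    obtain ⟨T, hT, hTmax⟩ := ih (by omega)
    have hne : (Tᶜ).Nonempty := by
      rw [← Finset.card_pos, Finset.card_compl]; omega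
    obtain ⟨a, ha, hamax⟩ := Finset.exists_max_image Tᶜ f hne
    rw [Finset.mem_compl] at ha
    refine ⟨insert a T, by rw [Finset.card_insert_of_notMem ha, hT], fun i hi j hj => ?_⟩
    rw [Finset.mem_insert, not_or] at hj
    rcases Finset.mem_insert.1 hi with rfl | hi
    · exact hamax j (by simpa using hj.2)
    · exact hTmax i hi j hj.2

theorem lpNorm_coordRestrict_add_le {p : ℝ} (hp0 : 0 < p) (hp1 : p ≤ 1) (S : Finset ι)
    (x : ι → 𝕜) :
    _root_.lpNorm p (coordRestrict S x) + _root_.lpNorm p (coordRestrict Sᶜ x)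
      ≤ _root_.lpNorm p x := by
  unfold _root_.lpNorm
  rw [sum_norm_coordRestrict_rpow hp0, sum_norm_coordRestrict_rpow hp0,
    ← Finset.sum_add_sum_compl S fun i => ‖x i‖ ^ p]
  exact Real.add_rpow_le_rpow_add (by positivity) (by positivity)
    ((one_le_div hp0).2 hp1)

theorem lpNorm_two_coordRestrict_le {p : ℝ} (hp0 : 0 < p) {t : ℕ} (ht : 0 < t) {μ : ℝ}
    (hμ : 0 ≤ μ) {x y : ι → 𝕜} {S T : Finset ι} (hS : #S ≤ t) (hT : #T = t)
    (hx : ∀ i, ‖x i‖ ≤ μ) (hy : ∀ i ∈ T, μ ≤ ‖y i‖) :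
    _root_.lpNorm 2 (coordRestrict S x)
      ≤ (t : ℝ) ^ (1 / 2 - 1 / p) * _root_.lpNorm p (coordRestrict T y) := by
  have ht' : (0 : ℝ) < t := by exact_mod_cast ht
  have h1 : _root_.lpNorm 2 (coordRestrict S x) ≤ (t : ℝ) ^ (1 / 2 : ℝ) * μ := by
    unfold _root_.lpNorm
    rw [sum_norm_coordRestrict_rpow two_pos]
    calc (∑ i ∈ S, ‖x i‖ ^ (2 : ℝ)) ^ (1 / 2 : ℝ)
        ≤ ((t : ℝ) * μ ^ (2 : ℝ)) ^ (1 / 2 : ℝ) := by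
          gcongr
          calc ∑ i ∈ S, ‖x i‖ ^ (2 : ℝ) ≤ ∑ i ∈ S, μ ^ (2 : ℝ) := by
                gcongr with i; exact hx i
            _ = (#S : ℝ) * μ ^ (2 : ℝ) := by simp
            _ ≤ (t : ℝ) * μ ^ (2 : ℝ) := by gcongr
      _ = (t : ℝ) ^ (1 / 2 : ℝ) * μ := by
          rw [Real.mul_rpow ht'.le (by positivity), ← Real.rpow_mul hμ]; norm_num
  have h2 : (t : ℝ) ^ (1 / p) * μ ≤ _root_.lpNorm p (coordRestrict T y) := by
    unfold _root_.lpNorm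
    rw [sum_norm_coordRestrict_rpow hp0]
    calc (t : ℝ) ^ (1 / p) * μ = ((t : ℝ) * μ ^ p) ^ (1 / p) := by
          rw [Real.mul_rpow ht'.le (by positivity), ← Real.rpow_mul hμ,
            mul_one_div_cancel hp0.ne', Real.rpow_one]
      _ = (∑ i ∈ T, μ ^ p) ^ (1 / p) := by simp [hT]
      _ ≤ (∑ i ∈ T, ‖y i‖ ^ p) ^ (1 / p) := by
          gcongr with i hi; exact hy i hi
  calc _ ≤ (t : ℝ) ^ (1 / 2 : ℝ) * μ := h1
    _ = (t : ℝ) ^ (1 / 2 - 1 / p) * ((t : ℝ) ^ (1 / p) * μ) := by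
        rw [← mul_assoc, ← Real.rpow_add ht']; norm_num
    _ ≤ _ := by gcongr

/-- If a subadditive functional is bounded by `U‖·‖₂` on `t`-sparse vectors, then removing
suitable `t` coordinates from `w` leaves a vector on which it is at most
`U t^{1/2-1/p} ‖w‖_p`. -/
theorem exists_card_le_apply_coordRestrict_compl_le {p : ℝ} (hp0 : 0 < p) (hp1 : p ≤ 1)
    {U : ℝ} (hU : 0 ≤ U) {t : ℕ} (ht : 0 < t) (N : (ι → 𝕜) → ℝ)
    (hadd : ∀ v w, N (v + w) ≤ N v + N w)
    (hN : ∀ v, l0Norm v ≤ t → N v ≤ U * _root_.lpNorm 2 v) (w : ι → 𝕜) :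
    ∃ T : Finset ι, #T ≤ t ∧
      N (coordRestrict Tᶜ w) ≤ U * ((t : ℝ) ^ (1 / 2 - 1 / p) * _root_.lpNorm p w) := by
  induction hs : l0Norm w using Nat.strong_induction_on generalizing w with
  | _ s ih =>
  subst hs
  by_cases hw : l0Norm w ≤ t
  · have hsupp : coordRestrict (Finset.univ.filter fun i => w i ≠ 0)ᶜ w = 0 := by
      ext i
      by_cases hi : w i = 0 <;> simp [coordRestrict, hi]
    refine ⟨Finset.univ.filter fun i => w i ≠ 0, ?_, ?_⟩
    · unfold l0Norm at hw
      convert hw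
    · rw [hsupp]
      have h0 : N 0 ≤ U * _root_.lpNorm 2 (0 : ι → 𝕜) := hN 0 (by simp [l0Norm])
      have h1 : _root_.lpNorm 2 (0 : ι → 𝕜) = 0 := by simp [lpNorm_two_eq_norm]
      rw [h1, mul_zero] at h0
      have := lpNorm_nonneg' p w
      exact h0.trans (by positivity)
  · push Not at hw
    have hcard : t ≤ Fintype.card ι :=
      hw.le.trans (by simpa using l0Norm_le_card Finset.univ (x := w) (by simp))
    obtain ⟨T, hT, hTmax⟩ := exists_card_eq_forall_le (fun i => ‖w i‖) t hcard
    have hTne : T.Nonempty := by rw [← Finset.card_pos]; omega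
    obtain ⟨a, ha, hamin⟩ := Finset.exists_min_image T (fun i => ‖w i‖) hTne
    have hsmall : ∀ i, ‖coordRestrict Tᶜ w i‖ ≤ ‖w a‖ := fun i => by
      by_cases hi : i ∈ T
      · simp [coordRestrict, hi]
      · simpa [coordRestrict, hi] using hTmax a ha i hi
    have hwa : w a ≠ 0 := fun h0 => by
      have : l0Norm w ≤ #T := l0Norm_le_card T fun j hj => by
        by_contra hjT
        have := hTmax a ha j hjT
        simp only [h0, norm_zero] at this
        exact hj (norm_le_zero_iff.1 this)
      omega
    have hlt : l0Norm (coordRestrict Tᶜ w) < l0Norm w := by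
      unfold l0Norm
      refine Finset.card_lt_card (Finset.ssubset_iff_subset_ne.2 ⟨fun i hi => ?_, fun h => ?_⟩)
      · by_cases hiT : i ∈ T <;> simp_all [coordRestrict]
      · have : a ∈ Finset.univ.filter fun i => w i ≠ 0 := by simp [hwa]
        have h' := Finset.ext_iff.1 h a
        simp [coordRestrict, ha, hwa] at h'
    obtain ⟨T', hT', hNT'⟩ := ih _ hlt (coordRestrict Tᶜ w) rfl
    refine ⟨T, hT.le, ?_⟩
    have h1 := hadd (coordRestrict T' (coordRestrict Tᶜ w))
      (coordRestrict T'ᶜ (coordRestrict Tᶜ w))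
    rw [coordRestrict_add_compl] at h1
    have h2 := hN _ ((l0Norm_coordRestrict_le T' (coordRestrict Tᶜ w)).trans hT')
    have h3 := lpNorm_two_coordRestrict_le hp0 ht (norm_nonneg (w a)) hT' hT hsmall hamin
    have h4 := lpNorm_coordRestrict_add_le hp0 hp1 T w
    have ht' : (0 : ℝ) ≤ (t : ℝ) ^ (1 / 2 - 1 / p) := by positivity
    calc N (coordRestrict Tᶜ w)
        ≤ U * ((t : ℝ) ^ (1 / 2 - 1 / p) * _root_.lpNorm p (coordRestrict T w))
          + U * ((t : ℝ) ^ (1 / 2 - 1 / p) * _root_.lpNorm p (coordRestrict Tᶜ w)) :=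
          h1.trans (add_le_add (h2.trans (mul_le_mul_of_nonneg_left h3 hU)) hNT')
      _ = U * ((t : ℝ) ^ (1 / 2 - 1 / p) * (_root_.lpNorm p (coordRestrict T w)
          + _root_.lpNorm p (coordRestrict Tᶜ w))) := by ring
      _ ≤ _ := by gcongr

/-- Comparison of `ℓ_p` and `ℓ_2` on a set of at most `k` coordinates. -/
theorem sum_norm_rpow_le_card_rpow_mul {p : ℝ} (hp0 : 0 < p) (hp2 : p < 2) {k : ℕ}
    {S : Finset ι} (hS : #S ≤ k) (x : ι → 𝕜) :
    ∑ i ∈ S, ‖x i‖ ^ p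
      ≤ (k : ℝ) ^ (1 - p / 2) * _root_.lpNorm 2 (coordRestrict S x) ^ p := by
  have hconj : (2 / p).HolderConjugate (2 / (2 - p)) := by
    rw [Real.holderConjugate_iff]
    refine ⟨(one_lt_div hp0).2 hp2, ?_⟩
    have : 2 - p ≠ 0 := by linarith
    field_simp
    ring
  have h := Real.inner_le_Lp_mul_Lq_of_nonneg S hconj (f := fun i => ‖x i‖ ^ p)
    (g := fun _ => 1) (fun i _ => by positivity) (fun i _ => zero_le_one)
  have hpow : ∀ i, (‖x i‖ ^ p) ^ (2 / p) = ‖x i‖ ^ (2 : ℝ) := fun i => by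
    rw [← Real.rpow_mul (norm_nonneg _), mul_div_cancel₀ _ hp0.ne']
  have he : 1 / (2 / (2 - p)) = 1 - p / 2 := by field_simp
  simp only [mul_one, hpow, Real.one_rpow, Finset.sum_const, nsmul_eq_mul, he] at h
  refine h.trans ?_
  unfold _root_.lpNorm
  rw [sum_norm_coordRestrict_rpow two_pos, ← Real.rpow_mul (by positivity), mul_comm]
  have he' : 1 / (2 / p) = 1 / 2 * p := by field_simp
  rw [he']
  have : 0 ≤ 1 - p / 2 := by linarith
  gcongr

/-- The cone condition satisfied by a vector `z` whose `ℓ_p` norm does not exceed that of `x`. -/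
theorem sum_compl_norm_rpow_le {p : ℝ} (hp0 : 0 < p) (hp1 : p ≤ 1) {c : 𝕜} (hc : ‖c‖ = 1)
    {x z : ι → 𝕜} (S : Finset ι) (h : ∑ i, ‖z i‖ ^ p ≤ ∑ i, ‖x i‖ ^ p) :
    ∑ i ∈ Sᶜ, ‖z i‖ ^ p ≤ ∑ i ∈ S, ‖z i - c * x i‖ ^ p + ∑ i ∈ Sᶜ, ‖x i‖ ^ p := by
  rw [← Finset.sum_add_sum_compl S, ← Finset.sum_add_sum_compl S fun i => ‖x i‖ ^ p] at h
  have h1 : ∑ i ∈ S, ‖x i‖ ^ p ≤ ∑ i ∈ S, ‖z i‖ ^ p + ∑ i ∈ S, ‖z i - c * x i‖ ^ p := by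
    rw [← Finset.sum_add_distrib]
    gcongr with i
    simpa [hc] using norm_sub_rpow_le hp0 hp1 (z i) (z i - c * x i)
  linarith

end Auxiliary

section Matrices

variable {m n : ℕ} {𝕜 : Type*} [RCLike 𝕜]

theorem lpNorm_absMv_sub_le (A : Fin m → Fin n → 𝕜) (x y : Fin n → 𝕜) :
    _root_.lpNorm 2 (fun i => absMv A x i - absMv A y i) ≤ _root_.lpNorm 2 (absMv A (x - y)) := by
  refine lpNorm_le_lpNorm_of_norm_le two_pos fun i => ?_
  simp only [absMv, Pi.sub_apply, mul_sub, Finset.sum_sub_distrib, norm_norm]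
  exact abs_norm_sub_norm_le _ _

theorem lpNorm_absMv_add_le (A : Fin m → Fin n → 𝕜) (x y : Fin n → 𝕜) :
    _root_.lpNorm 2 (absMv A (x + y))
      ≤ _root_.lpNorm 2 (absMv A x) + _root_.lpNorm 2 (absMv A y) := by
  refine le_trans (lpNorm_le_lpNorm_of_norm_le two_pos fun i => ?_)
    (lpNorm_two_add_le (absMv A x) (absMv A y))
  simp only [absMv, Pi.add_apply, mul_add, Finset.sum_add_distrib, norm_norm]
  exact (norm_add_le _ _).trans (le_abs_self _)

theorem PhaselessBiLip.lpNorm_absMv_le {A : Fin m → Fin n → 𝕜} {X : Set (Fin n → 𝕜)} {L U : ℝ}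
    (hA : PhaselessBiLip A X L U) (hU : 0 ≤ U) (h0 : 0 ∈ X) {v : Fin n → 𝕜} (hv : v ∈ X) :
    _root_.lpNorm 2 (absMv A v) ≤ U * _root_.lpNorm 2 v := by
  have h := (hA v hv 0 h0).2
  have h1 := phaseDist_le (q := 2) v 0 (norm_one (α := 𝕜))
  simp only [absMv, Pi.zero_apply, mul_zero, Finset.sum_const_zero, norm_zero, sub_zero] at h h1
  exact h.trans (mul_le_mul_of_nonneg_left h1 hU)

end Matrices

section RealEstimates

theorem two_lt_of_gap_pos {p r L U δ : ℝ} (hp0 : 0 < p) (hp1 : p ≤ 1) (hr : 0 < r) (hL : 0 < L)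
    (hLU : L ≤ U) (hδdef : δ = L - U * 2 ^ (1 / p - 1) * (2 / r) ^ (1 / p - 1 / 2))
    (hδ : 0 < δ) : 2 < r := by
  by_contra! h
  have hp : 1 ≤ 1 / p := (one_le_div hp0).2 hp1
  have h1 : (1 : ℝ) ≤ 2 ^ (1 / p - 1) := Real.one_le_rpow one_le_two (by linarith)
  have h2 : (1 : ℝ) ≤ (2 / r) ^ (1 / p - 1 / 2) :=
    Real.one_le_rpow ((one_le_div hr).2 h) (by linarith)
  have h3 : U * 1 ≤ U * (2 ^ (1 / p - 1) * (2 / r) ^ (1 / p - 1 / 2)) :=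
    mul_le_mul_of_nonneg_left (one_le_mul_of_one_le_of_one_le h1 h2) (hL.le.trans hLU)
  linarith

theorem le_of_gap_pos {p r L U δ k t H σ W η : ℝ} (hp0 : 0 < p) (hp1 : p ≤ 1) (hr : 0 < r)
    (hU : 0 ≤ U) (hδdef : δ = L - U * 2 ^ (1 / p - 1) * (2 / r) ^ (1 / p - 1 / 2))
    (hδ : 0 < δ) (hk : 0 < k) (ht : r * k ≤ t) (hH : 0 ≤ H) (hW : 0 ≤ W)
    (hWle : W ≤ 2 ^ (1 / p - 1) * (k ^ (1 / p - 1 / 2) * H + σ))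
    (h : L * H ≤ 2 * η + U * (k ^ (1 / 2 - 1 / p) * σ) + U * (t ^ (1 / 2 - 1 / p) * W)) :
    H ≤ U * (2 ^ (1 / p - 1) / r ^ (1 / p - 1 / 2) + 1) / δ * (k ^ (1 / 2 - 1 / p) * σ)
      + 2 / δ * η := by
  have hp : 1 ≤ 1 / p := (one_le_div hp0).2 hp1
  have hneg : 1 / 2 - 1 / p = -(1 / p - 1 / 2) := by ring
  have hs : 0 ≤ 1 / p - 1 / 2 := by linarith
  have htr : t ^ (1 / 2 - 1 / p) ≤ r ^ (1 / 2 - 1 / p) * k ^ (1 / 2 - 1 / p) := by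
    rw [← Real.mul_rpow hr.le hk.le]
    exact Real.rpow_le_rpow_of_nonpos (by positivity) ht (by linarith)
  have hkk : k ^ (1 / 2 - 1 / p) * k ^ (1 / p - 1 / 2) = 1 := by
    rw [← Real.rpow_add hk]; simp
  have htail : t ^ (1 / 2 - 1 / p) * W ≤ 2 ^ (1 / p - 1) / r ^ (1 / p - 1 / 2)
      * (H + k ^ (1 / 2 - 1 / p) * σ) := by
    calc t ^ (1 / 2 - 1 / p) * W
        ≤ (r ^ (1 / 2 - 1 / p) * k ^ (1 / 2 - 1 / p))
          * (2 ^ (1 / p - 1) * (k ^ (1 / p - 1 / 2) * H + σ)) := by gcongr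
      _ = 2 ^ (1 / p - 1) * r ^ (1 / 2 - 1 / p)
          * ((k ^ (1 / 2 - 1 / p) * k ^ (1 / p - 1 / 2)) * H + k ^ (1 / 2 - 1 / p) * σ) := by
        ring
      _ = _ := by
        rw [hkk, one_mul, hneg, Real.rpow_neg hr.le, ← div_eq_mul_inv]
  have hδle : δ ≤ L - U * (2 ^ (1 / p - 1) / r ^ (1 / p - 1 / 2)) := by
    have h2 : 1 / r ^ (1 / p - 1 / 2) ≤ (2 / r) ^ (1 / p - 1 / 2) := by
      rw [Real.div_rpow two_pos.le hr.le]
      gcongr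
      exact Real.one_le_rpow one_le_two hs
    have h3 : U * 2 ^ (1 / p - 1) * (1 / r ^ (1 / p - 1 / 2))
        ≤ U * 2 ^ (1 / p - 1) * (2 / r) ^ (1 / p - 1 / 2) := by gcongr
    have h4 : U * (2 ^ (1 / p - 1) / r ^ (1 / p - 1 / 2))
        = U * 2 ^ (1 / p - 1) * (1 / r ^ (1 / p - 1 / 2)) := by ring
    linarith
  have h5 := mul_le_mul_of_nonneg_left htail hU
  have h6 := mul_le_mul_of_nonneg_right hδle hH
  have h7 : δ * H ≤ U * (2 ^ (1 / p - 1) / r ^ (1 / p - 1 / 2) + 1)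
      * (k ^ (1 / 2 - 1 / p) * σ) + 2 * η := by linarith
  rw [div_mul_eq_mul_div, div_mul_eq_mul_div, ← add_div, le_div_iff₀ hδ]
  linarith

theorem le_of_rpow_le {p r C D k H σ η d : ℝ} (hp0 : 0 < p) (hp1 : p ≤ 1) (hr : 2 ≤ r)
    (hC : 0 ≤ C) (hD : 0 ≤ D) (hk : 0 < k) (hH : 0 ≤ H) (hσ : 0 ≤ σ) (hη : 0 ≤ η) (hd : 0 ≤ d)
    (hHle : H ≤ C * (k ^ (1 / 2 - 1 / p) * σ) + D * η)
    (hdle : d ^ p ≤ 2 * (k ^ (1 - p / 2) * H ^ p) + 2 * σ ^ p) :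
    d ≤ 2 ^ (1 / p - 1) * (2 * ((2 + r) ^ (1 - p / 2) * C ^ p) + 2) ^ (1 / p) * σ
      + 2 ^ (1 / p - 1) * ((2 + r) ^ (1 - p / 2) * D ^ p) ^ (1 / p)
        * k ^ (1 / p - 1 / 2) * η := by
  have hR : 2 ≤ (2 + r) ^ (1 - p / 2) := by
    calc (2 : ℝ) = 4 ^ (1 / 2 : ℝ) := by
          rw [← Real.sqrt_eq_rpow, show (4 : ℝ) = 2 ^ 2 by norm_num, Real.sqrt_sq two_pos.le]
      _ ≤ 4 ^ (1 - p / 2) := Real.rpow_le_rpow_of_exponent_le (by norm_num) (by linarith)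
      _ ≤ (2 + r) ^ (1 - p / 2) := Real.rpow_le_rpow (by norm_num) (by linarith) (by linarith)
  set R := (2 + r) ^ (1 - p / 2)
  have hroot : ∀ {y : ℝ}, 0 ≤ y → (y ^ p) ^ (1 / p) = y := fun {y} hy => by
    rw [← Real.rpow_mul hy, mul_one_div_cancel hp0.ne', Real.rpow_one]
  have hHp : H ^ p ≤ C ^ p * (k ^ (p / 2 - 1) * σ ^ p) + D ^ p * η ^ p := by
    calc H ^ p ≤ (C * (k ^ (1 / 2 - 1 / p) * σ) + D * η) ^ p := by gcongr
      _ ≤ (C * (k ^ (1 / 2 - 1 / p) * σ)) ^ p + (D * η) ^ p :=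
        Real.rpow_add_le_add_rpow (by positivity) (by positivity) hp0.le hp1
      _ = _ := by
        rw [Real.mul_rpow hC (by positivity), Real.mul_rpow (by positivity) hσ,
          Real.mul_rpow hD hη, ← Real.rpow_mul hk.le]
        congr 4
        field_simp
  have hkk : k ^ (1 - p / 2) * k ^ (p / 2 - 1) = 1 := by
    rw [← Real.rpow_add hk]; simp
  have hmain : d ^ p ≤ (2 * (R * C ^ p) + 2) * σ ^ p
      + R * D ^ p * (k ^ (1 - p / 2) * η ^ p) := by
    calc d ^ p ≤ 2 * (k ^ (1 - p / 2) * (C ^ p * (k ^ (p / 2 - 1) * σ ^ p) + D ^ p * η ^ p))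
          + 2 * σ ^ p := hdle.trans (by gcongr)
      _ = (2 * C ^ p + 2) * σ ^ p + 2 * D ^ p * (k ^ (1 - p / 2) * η ^ p) := by
        linear_combination 2 * C ^ p * σ ^ p * hkk
      _ ≤ _ := by
        gcongr
        exact le_mul_of_one_le_left (by positivity) (by linarith)
  calc d = (d ^ p) ^ (1 / p) := (hroot hd).symm
    _ ≤ _ := Real.rpow_le_rpow (by positivity) hmain (by positivity)
    _ ≤ _ := add_rpow_one_div_le hp0 hp1 (by positivity) (by positivity)
    _ = _ := by
      rw [Real.mul_rpow (by positivity) (by positivity), hroot hσ,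
        Real.mul_rpow (x := R * D ^ p) (by positivity) (by positivity),
        Real.mul_rpow (x := k ^ (1 - p / 2)) (by positivity) (by positivity), hroot hη,
        ← Real.rpow_mul hk.le]
      have : (1 - p / 2) * (1 / p) = 1 / p - 1 / 2 := by field_simp
      rw [this]
      ring

end RealEstimates

/-- Theorem `th:main11`, the `dist_p` bound: under the phaseless bi-Lipschitz
condition on `(r+4)k`-sparse vectors, any feasible `ℓ_p`-minimizer `x♯` satisfies
`dist_p(x♯, x) ≤ 2^{1/p-1}(2C̃₁+2)^{1/p} σ_k(x)_p + 2^{1/p-1} D̃₁^{1/p} k^{1/p-1/2} η`. -/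
theorem stmt0 {𝕜 : Type*} [RCLike 𝕜] (k m n : ℕ) (hk : 0 < k) (hm : 0 < m) (hn : 0 < n)
    (hkn : k ≤ n) (p : ℝ) (hp0 : 0 < p) (hp1 : p ≤ 1)
    (r L U : ℝ) (hr : 0 < r) (hL : 0 < L) (hLU : L ≤ U)
    (δ : ℝ) (hδdef : δ = L - U * 2 ^ (1 / p - 1) * (2 / r) ^ (1 / p - 1 / 2)) (hδ : 0 < δ)
    (A : Fin m → Fin n → 𝕜)
    (hA : PhaselessBiLip A {z | (l0Norm z : ℝ) ≤ (r + 4) * k} L U)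
    (C₂ C₁ D₁ : ℝ)
    (hC₂ : C₂ = U * (2 ^ (1 / p - 1) / r ^ (1 / p - 1 / 2) + 1) / δ)
    (hC₁ : C₁ = (2 + r) ^ (1 - p / 2) * C₂ ^ p)
    (hD₁ : D₁ = (2 + r) ^ (1 - p / 2) * (2 / δ) ^ p)
    (x xs : Fin n → 𝕜) (η : ℝ) (hη : 0 ≤ η) (e : Fin m → ℝ) (he : lpNorm 2 e ≤ η)
    (hfeas : lpNorm 2 (fun i => absMv A xs i - (absMv A x i + e i)) ≤ η)
    (hmin : lpNorm p xs ^ p ≤ lpNorm p x ^ p) :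
    phaseDist p xs x ≤
      2 ^ (1 / p - 1) * (2 * C₁ + 2) ^ (1 / p) * sigmaK k p x
        + 2 ^ (1 / p - 1) * D₁ ^ (1 / p) * (k : ℝ) ^ (1 / p - 1 / 2) * η := by
  have hU : 0 ≤ U := hL.le.trans hLU
  have hk' : (0 : ℝ) < k := by exact_mod_cast hk
  have hr2 : 2 < r := two_lt_of_gap_pos hp0 hp1 hr hL hLU hδdef hδ
  have hC₂0 : 0 ≤ C₂ := by rw [hC₂]; positivity
  rw [lpNorm_rpow_eq_sum hp0, lpNorm_rpow_eq_sum hp0] at hmin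
  have key : ∀ S : Finset (Fin n), #S ≤ k → phaseDist p xs x ≤
      2 ^ (1 / p - 1) * (2 * C₁ + 2) ^ (1 / p) * _root_.lpNorm p (coordRestrict Sᶜ x)
        + 2 ^ (1 / p - 1) * D₁ ^ (1 / p) * (k : ℝ) ^ (1 / p - 1 / 2) * η := by
    intro S hS
    set t := ⌈r * k⌉₊
    have ht : 0 < t := Nat.ceil_pos.2 (by positivity)
    have htle : r * k ≤ t := Nat.le_ceil _
    have htlt : (t : ℝ) < r * k + 1 := Nat.ceil_lt_add_one (by positivity)
    have hk1 : (1 : ℝ) ≤ k := by exact_mod_cast hk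
    have hsparse : ∀ {v : Fin n → 𝕜}, l0Norm v ≤ k + t →
        v ∈ {z : Fin n → 𝕜 | (l0Norm z : ℝ) ≤ (r + 4) * k} := fun {v} hv => by
      have : (l0Norm v : ℝ) ≤ k + t := by exact_mod_cast hv
      simp only [Set.mem_ofPred_eq]
      nlinarith
    have hkt : k ≤ t := by
      have : (k : ℝ) ≤ t := by nlinarith
      exact_mod_cast this
    have hN : ∀ v : Fin n → 𝕜, l0Norm v ≤ k + t →
        _root_.lpNorm 2 (absMv A v) ≤ U * _root_.lpNorm 2 v := fun v hv =>
      hA.lpNorm_absMv_le hU (hsparse (by simp [l0Norm])) (hsparse hv)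
    obtain ⟨T₁, hT₁, hx⟩ := exists_card_le_apply_coordRestrict_compl_le hp0 hp1 hU hk
      (fun v => _root_.lpNorm 2 (absMv A v)) (lpNorm_absMv_add_le A)
      (fun v hv => hN v (by omega)) (coordRestrict Sᶜ x)
    obtain ⟨T₂, hT₂, hz⟩ := exists_card_le_apply_coordRestrict_compl_le hp0 hp1 hU ht
      (fun v => _root_.lpNorm 2 (absMv A v)) (lpNorm_absMv_add_le A)
      (fun v hv => hN v (by omega)) (coordRestrict Sᶜ xs)
    set σ := _root_.lpNorm p (coordRestrict Sᶜ x)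
    set W := _root_.lpNorm p (coordRestrict Sᶜ xs)
    set a := coordRestrict (S ∪ T₁) x
    set b := coordRestrict (S ∪ T₂) xs
    have hxa : x - a = coordRestrict T₁ᶜ (coordRestrict Sᶜ x) := by
      ext i
      by_cases h1 : i ∈ S <;> by_cases h2 : i ∈ T₁ <;> simp [a, coordRestrict, h1, h2]
    have hzb : b - xs = -coordRestrict T₂ᶜ (coordRestrict Sᶜ xs) := by
      ext i
      by_cases h1 : i ∈ S <;> by_cases h2 : i ∈ T₂ <;> simp [b, coordRestrict, h1, h2]
    have ha := hsparse (v := a) ((l0Norm_coordRestrict_le _ x).trans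
      ((Finset.card_union_le S T₁).trans (by omega)))
    have hb := hsparse (v := b) ((l0Norm_coordRestrict_le _ xs).trans
      ((Finset.card_union_le S T₂).trans (by omega)))
    obtain ⟨c, hc, hdist⟩ := exists_phaseDist_eq two_pos b a
    set h : Fin n → 𝕜 := fun i => xs i - c * x i
    have hHle : _root_.lpNorm 2 (coordRestrict S h) ≤ phaseDist 2 b a := by
      rw [hdist]
      refine lpNorm_le_lpNorm_of_norm_le two_pos fun i => ?_
      by_cases hi : i ∈ S <;> simp [a, b, h, coordRestrict, hi]
    set H := _root_.lpNorm 2 (coordRestrict S h)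
    have hσp : σ ^ p = ∑ i ∈ Sᶜ, ‖x i‖ ^ p := by
      rw [lpNorm_rpow_eq_sum hp0, sum_norm_coordRestrict_rpow hp0]
    have hWp : W ^ p = ∑ i ∈ Sᶜ, ‖xs i‖ ^ p := by
      rw [lpNorm_rpow_eq_sum hp0, sum_norm_coordRestrict_rpow hp0]
    have hcone := sum_compl_norm_rpow_le hp0 hp1 hc S hmin
    rw [← hσp, ← hWp] at hcone
    have hhS : ∑ i ∈ S, ‖h i‖ ^ p ≤ (k : ℝ) ^ (1 - p / 2) * H ^ p :=
      sum_norm_rpow_le_card_rpow_mul hp0 (by linarith) hS h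
    have hH0 : 0 ≤ H := lpNorm_nonneg' _ _
    have hσ0 : 0 ≤ σ := lpNorm_nonneg' _ _
    have hW0 : 0 ≤ W := lpNorm_nonneg' _ _
    have hroot : ∀ {y : ℝ}, 0 ≤ y → (y ^ p) ^ (1 / p) = y := fun {y} hy => by
      rw [← Real.rpow_mul hy, mul_one_div_cancel hp0.ne', Real.rpow_one]
    have hWle : W ≤ 2 ^ (1 / p - 1) * ((k : ℝ) ^ (1 / p - 1 / 2) * H + σ) := by
      calc W = (W ^ p) ^ (1 / p) := (hroot hW0).symm
        _ ≤ ((k : ℝ) ^ (1 - p / 2) * H ^ p + σ ^ p) ^ (1 / p) :=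
          Real.rpow_le_rpow (by positivity) (hcone.trans (by gcongr)) (by positivity)
        _ ≤ _ := add_rpow_one_div_le hp0 hp1 (by positivity) (by positivity)
        _ = _ := by
          rw [Real.mul_rpow (by positivity) (by positivity), hroot hH0, hroot hσ0,
            ← Real.rpow_mul hk'.le]
          have : (1 - p / 2) * (1 / p) = 1 / p - 1 / 2 := by field_simp
          rw [this]
    have hmeas : L * H ≤ 2 * η + U * ((k : ℝ) ^ (1 / 2 - 1 / p) * σ)
        + U * ((t : ℝ) ^ (1 / 2 - 1 / p) * W) := by
      have h1 : (fun i => absMv A b i - absMv A a i)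
          = (fun i => absMv A b i - absMv A xs i)
            + ((fun i => absMv A xs i - (absMv A x i + e i))
              + (e + fun i => absMv A x i - absMv A a i)) := by
        ext i
        simp only [Pi.add_apply]
        ring
      have h2 := lpNorm_two_add_le (fun i => absMv A b i - absMv A xs i)
        ((fun i => absMv A xs i - (absMv A x i + e i))
          + (e + fun i => absMv A x i - absMv A a i))
      have h3 := lpNorm_two_add_le (fun i => absMv A xs i - (absMv A x i + e i))
        (e + fun i => absMv A x i - absMv A a i)
      have h4 := lpNorm_two_add_le e (fun i => absMv A x i - absMv A a i)
      have h5 := lpNorm_absMv_sub_le A x a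
      have h6 := lpNorm_absMv_sub_le A b xs
      have h7 : absMv A (-coordRestrict T₂ᶜ (coordRestrict Sᶜ xs))
          = absMv A (coordRestrict T₂ᶜ (coordRestrict Sᶜ xs)) := by
        ext i
        simp [absMv]
      rw [hxa] at h5
      rw [hzb, h7] at h6
      have h8 := (hA b hb a ha).1
      rw [h1] at h8
      have h9 := mul_le_mul_of_nonneg_left hHle hL.le
      linarith
    have hHbound := le_of_gap_pos hp0 hp1 hr hU hδdef hδ hk' htle hH0 hW0 hWle hmeas
    rw [← hC₂] at hHbound
    have hdp : _root_.lpNorm p h ^ p ≤ 2 * ((k : ℝ) ^ (1 - p / 2) * H ^ p) + 2 * σ ^ p := by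
      rw [lpNorm_rpow_eq_sum hp0, ← Finset.sum_add_sum_compl S]
      have h1 : ∑ i ∈ Sᶜ, ‖h i‖ ^ p ≤ W ^ p + σ ^ p := by
        rw [hWp, hσp, ← Finset.sum_add_distrib]
        gcongr with i
        simpa [hc] using norm_sub_rpow_le hp0 hp1 (xs i) (c * x i)
      linarith
    rw [hC₁, hD₁]
    exact (phaseDist_le xs x hc).trans (le_of_rpow_le hp0 hp1 hr2.le hC₂0 (by positivity) hk'
      hH0 hσ0 hη (lpNorm_nonneg' _ _) hHbound hdp)
  set K := (2 : ℝ) ^ (1 / p - 1) * (2 * C₁ + 2) ^ (1 / p)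
  have hK : 0 < K := by
    have : 0 ≤ C₁ := by rw [hC₁]; positivity
    positivity
  rw [← sub_le_iff_le_add, ← div_le_iff₀' hK]
  refine le_csInf ⟨_, 0, by simp [l0Norm], rfl⟩ ?_
  rintro _ ⟨z, hz, rfl⟩
  classical
  rw [div_le_iff₀' hK, sub_le_iff_le_add]
  have hcard : #(Finset.univ.filter fun i => z i ≠ 0) ≤ k := by
    unfold l0Norm at hz
    convert hz
  refine (key _ hcard).trans ?_
  gcongr
  refine lpNorm_le_lpNorm_of_norm_le hp0 fun i => ?_
  by_cases hi : z i = 0 <;> simp [coordRestrict, hi]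
end

section
/- There exists a universal constant c₀ > 0 with the following property. Let p ∈ (0,1] and let r > 0 satisfy 1 − (√(π/(π−2)) + 0.01)·2^{1/p−1}·(2/r)^{1/p−1/2} > 0. Then there exists a constant C > 0 depending only on r such that for all positive integers k ≤ n and all m ≥ C·k·log(en/k): if A ∈ ℝ^{m×n} is a standard Gaussian random matrix, then with probability at least 1 − exp(−c₀·m) there exist constants L, U > 0 with √(π/(π−2)) ≤ U/L ≤ √(π/(π−2)) + 0.01 such that A satisfies the phaseless bi-Lipschitz condition with constants L, U on the set {z ∈ ℝ^n : ‖z‖₀ ≤ (r+4)k}. -/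
open MeasureTheory ProbabilityTheory Real Finset

/-- The law of a standard Gaussian random matrix `A ∈ ℝ^{m×n}`: the product over the `m·n`
entries of the real Gaussian measure with mean `0` and variance `1`. -/
noncomputable def gaussMatrixReal (m n : ℕ) : Measure (Fin m → Fin n → ℝ) :=
  Measure.pi fun _ : Fin m => Measure.pi fun _ : Fin n => gaussianReal 0 1

section GaussianMoments

open scoped RealInnerProductSpace

lemma integrable_pow_four_mul_exp_gaussianReal :
    Integrable (fun x : ℝ => x ^ 4 * Real.exp (x ^ 2 / 8)) (gaussianReal 0 1) := by
  rw [gaussianReal_of_var_ne_zero 0 one_ne_zero, integrable_withDensity_iff_integrable_smul'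
    (measurable_gaussianPDF 0 1) (Filter.Eventually.of_forall fun _ => gaussianPDF_lt_top)]
  have h := (integrable_rpow_mul_exp_neg_mul_sq (b := 3 / 8) (by norm_num)
    (s := 4) (by norm_num)).const_mul ((√(2 * π))⁻¹)
  refine h.congr (Filter.Eventually.of_forall fun x => ?_)
  simp only [toReal_gaussianPDF, gaussianPDFReal, smul_eq_mul, NNReal.coe_one, mul_one, sub_zero]
  rw [show (4 : ℝ) = ((4 : ℕ) : ℝ) by norm_num, Real.rpow_natCast,
    show -(3 / 8) * x ^ 2 = -x ^ 2 / 2 + x ^ 2 / 8 by ring, Real.exp_add]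
  ring

lemma integral_abs_gaussianReal_zero_one : ∫ x, |x| ∂(gaussianReal 0 1) = √(2 / π) := by
  rw [integral_gaussianReal_eq_integral_smul one_ne_zero]
  have h1 : ∀ x : ℝ, gaussianPDFReal 0 1 x • |x|
      = (√(2 * π))⁻¹ * (fun y : ℝ => y ^ (1 : ℝ) * Real.exp (-(1 / 2) * y ^ (2 : ℝ))) |x| := by
    intro x
    simp only [gaussianPDFReal, smul_eq_mul, NNReal.coe_one, mul_one, sub_zero, Real.rpow_one,
      Real.rpow_two, sq_abs]
    rw [show -(1 / 2) * x ^ 2 = -x ^ 2 / 2 by ring]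
    ring
  simp_rw [h1]
  rw [integral_const_mul, integral_comp_abs
    (f := fun y : ℝ => y ^ (1 : ℝ) * Real.exp (-(1 / 2) * y ^ (2 : ℝ))),
    integral_rpow_mul_exp_neg_mul_rpow (p := 2) (q := 1) (b := 1 / 2) (by norm_num) (by norm_num)
      (by norm_num)]
  norm_num
  have : (0 : ℝ) < √π := Real.sqrt_pos.2 Real.pi_pos
  have h2 : √(2:ℝ) * √2 = 2 := Real.mul_self_sqrt (by norm_num)
  field_simp
  nlinarith

variable {n : ℕ}

lemma map_inner_stdGaussian (u : EuclideanSpace ℝ (Fin n)) :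
    (stdGaussian (EuclideanSpace ℝ (Fin n))).map (fun a => ⟪u, a⟫) =
      (gaussianReal 0 1).map (fun x => ‖u‖ * x) := by
  apply Measure.ext_of_charFun
  ext t
  rw [gaussianReal_map_const_mul, charFun_gaussianReal]
  rw [charFun_apply_real, integral_map (by fun_prop) (by fun_prop)]
  have := charFun_stdGaussian (E := EuclideanSpace ℝ (Fin n)) (t • u)
  rw [charFun_apply] at this
  simp only [inner_smul_right, real_inner_comm] at this ⊢
  simp only [Complex.ofReal_mul] at this
  rw [this, norm_smul]
  congr 1
  simp
  rw [mul_pow, ← Complex.ofReal_pow |t|, sq_abs]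
  push_cast
  ring

lemma integral_comp_inner_stdGaussian {u : EuclideanSpace ℝ (Fin n)} (hu : ‖u‖ = 1) (f : ℝ → ℝ)
    (hf : Measurable f) :
    ∫ a, f ⟪u, a⟫ ∂(stdGaussian (EuclideanSpace ℝ (Fin n))) = ∫ x, f x ∂(gaussianReal 0 1) := by
  have h := map_inner_stdGaussian u
  simp only [hu, one_mul, Measure.map_id'] at h
  rw [← h, integral_map (by fun_prop) (by fun_prop)]

lemma integrable_comp_inner_stdGaussian {u : EuclideanSpace ℝ (Fin n)} (hu : ‖u‖ = 1) {f : ℝ → ℝ}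
    (hf : Integrable f (gaussianReal 0 1)) :
    Integrable (fun a => f ⟪u, a⟫) (stdGaussian (EuclideanSpace ℝ (Fin n))) := by
  have h := map_inner_stdGaussian u
  simp only [hu, one_mul, Measure.map_id'] at h
  rw [← h] at hf
  exact hf.comp_measurable (by fun_prop)

lemma integral_abs_inner_stdGaussian (w : EuclideanSpace ℝ (Fin n)) :
    ∫ a, |⟪w, a⟫| ∂(stdGaussian (EuclideanSpace ℝ (Fin n))) = ‖w‖ * √(2 / π) := by
  have h := map_inner_stdGaussian w
  have h1 := integral_map (μ := stdGaussian (EuclideanSpace ℝ (Fin n)))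
    (φ := fun a => ⟪w, a⟫) (by fun_prop) (f := fun x : ℝ => |x|) (by fun_prop)
  rw [← h1, h, integral_map (by fun_prop) (by fun_prop)]
  simp only [abs_mul, abs_norm]
  rw [integral_const_mul, integral_abs_gaussianReal_zero_one]

lemma indepFun_inner_stdGaussian {w z : EuclideanSpace ℝ (Fin n)} (h : ⟪w, z⟫ = 0) :
    IndepFun (fun a => ⟪w, a⟫) (fun a => ⟪z, a⟫)
      (stdGaussian (EuclideanSpace ℝ (Fin n))) := by
  have hid : HasGaussianLaw (fun a : EuclideanSpace ℝ (Fin n) => a)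
      (stdGaussian (EuclideanSpace ℝ (Fin n))) :=
    ⟨by rw [Measure.map_id']; infer_instance⟩
  have hXY := hid.map ((innerSL ℝ w).prod (innerSL ℝ z))
  refine HasGaussianLaw.indepFun_of_covariance_eq_zero hXY ?_
  rw [← covarianceBilin_apply_eq_cov IsGaussian.memLp_two_id, covarianceBilin_stdGaussian]
  exact h

lemma integral_abs_mul_abs_stdGaussian {w z : EuclideanSpace ℝ (Fin n)} (h : ⟪w, z⟫ = 0) :
    ∫ a, |⟪w, a⟫| * |⟪z, a⟫| ∂(stdGaussian (EuclideanSpace ℝ (Fin n))) = 2 / π * (‖w‖ * ‖z‖) := by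
  have hi := (indepFun_inner_stdGaussian h).comp (φ := fun x : ℝ => |x|) (ψ := fun x : ℝ => |x|)
    (by fun_prop) (by fun_prop)
  have := hi.integral_fun_mul_eq_mul_integral (by fun_prop) (by fun_prop)
  simp only [Function.comp_apply] at this
  rw [this, integral_abs_inner_stdGaussian, integral_abs_inner_stdGaussian]
  have h2 : √(2 / π) * √(2 / π) = 2 / π := Real.mul_self_sqrt (by positivity)
  linear_combination ‖w‖ * ‖z‖ * h2

lemma integrable_sq_gaussianReal : Integrable (fun x : ℝ => x ^ 2) (gaussianReal 0 1) :=
  (memLp_id_gaussianReal 2).integrable_sq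

lemma integral_sq_gaussianReal_zero_one : ∫ x, x ^ 2 ∂(gaussianReal 0 1) = 1 := by
  have h := variance_eq_sub (μ := gaussianReal 0 1) (X := id) (memLp_id_gaussianReal 2)
  simpa using h.symm

lemma min_sq_eq (a b : ℝ) : min (a ^ 2) (b ^ 2) = (a ^ 2 + b ^ 2) / 2 - |a - b| * |a + b| / 2 := by
  rw [← abs_mul, show (a - b) * (a + b) = a ^ 2 - b ^ 2 by ring]
  rcases le_total (a ^ 2) (b ^ 2) with h | h
  · rw [min_eq_left h, abs_of_nonpos (by linarith)]
    ring
  · rw [min_eq_right h, abs_of_nonneg (by linarith)]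
    ring

/-- For unit vectors `u` and `v`, the expected value of `min (⟪u, a⟫², ⟪v, a⟫²)` is minimal when
`u` and `v` are orthogonal, in which case it equals `1 - 2 / π`. -/
lemma le_integral_min_sq_stdGaussian {u v : EuclideanSpace ℝ (Fin n)} (hu : ‖u‖ = 1)
    (hv : ‖v‖ = 1) :
    1 - 2 / π ≤ ∫ a, min (⟪u, a⟫ ^ 2) (⟪v, a⟫ ^ 2) ∂(stdGaussian (EuclideanSpace ℝ (Fin n))) := by
  have iu := integrable_comp_inner_stdGaussian hu integrable_sq_gaussianReal
  have iv := integrable_comp_inner_stdGaussian hv integrable_sq_gaussianReal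
  have horth : ⟪u - v, u + v⟫ = 0 := by
    rw [inner_sub_left, inner_add_right, inner_add_right, real_inner_self_eq_norm_sq,
      real_inner_self_eq_norm_sq, hu, hv, real_inner_comm]
    ring
  have imin : Integrable (fun a => min (⟪u, a⟫ ^ 2) (⟪v, a⟫ ^ 2))
      (stdGaussian (EuclideanSpace ℝ (Fin n))) := iu.inf iv
  have e1 : ∀ a : EuclideanSpace ℝ (Fin n), |⟪u - v, a⟫| * |⟪u + v, a⟫|
      = ⟪u, a⟫ ^ 2 + ⟪v, a⟫ ^ 2 - 2 * min (⟪u, a⟫ ^ 2) (⟪v, a⟫ ^ 2) := by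
    intro a
    rw [min_sq_eq, inner_sub_left, inner_add_left]
    ring
  have h := integral_abs_mul_abs_stdGaussian horth
  simp_rw [e1] at h
  have iuv : Integrable (fun a => ⟪u, a⟫ ^ 2 + ⟪v, a⟫ ^ 2)
    (stdGaussian (EuclideanSpace ℝ (Fin n))) := iu.add iv
  rw [integral_sub iuv (imin.const_mul 2), integral_add iu iv, integral_const_mul,
    integral_comp_inner_stdGaussian hu (fun x => x ^ 2) (by fun_prop),
    integral_comp_inner_stdGaussian hv (fun x => x ^ 2) (by fun_prop),
    integral_sq_gaussianReal_zero_one] at h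
  have hp : ‖u - v‖ * ‖u + v‖ ≤ 2 := by
    have := parallelogram_law_with_norm ℝ u v
    rw [hu, hv] at this
    nlinarith [sq_nonneg (‖u - v‖ - ‖u + v‖)]
  have : 2 / π * (‖u - v‖ * ‖u + v‖) ≤ 2 / π * 2 := by gcongr
  linarith

end GaussianMoments

section Chernoff

open scoped RealInnerProductSpace

instance (m n : ℕ) : IsProbabilityMeasure (gaussMatrixReal m n) := by
  unfold gaussMatrixReal; infer_instance

/-- The constant in the quadratic bound for the moment generating function of functions dominated
by the square of a standard Gaussian variable. -/
noncomputable def mgfConst : ℝ := ∫ x, x ^ 4 * Real.exp (x ^ 2 / 8) ∂(gaussianReal 0 1)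

lemma mgfConst_nonneg : 0 ≤ mgfConst := integral_nonneg fun x => by positivity

lemma exp_mul_le_of_abs_le {c z : ℝ} (hc : |c| ≤ 1 / 8) (hz : 0 ≤ z) :
    Real.exp (c * z) ≤ 1 + c * z + c ^ 2 * (z ^ 2 * Real.exp (z / 8)) := by
  have h := Complex.norm_exp_sub_sum_le_norm_mul_exp ((c * z : ℝ) : ℂ) 2
  have h1 : Complex.exp ((c * z : ℝ) : ℂ)
      - ∑ i ∈ Finset.range 2, ((c * z : ℝ) : ℂ) ^ i / (i.factorial : ℂ)
      = ((Real.exp (c * z) - (1 + c * z) : ℝ) : ℂ) := by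
    simp [Finset.sum_range_succ]
  rw [h1, Complex.norm_real, Complex.norm_real, Real.norm_eq_abs, Real.norm_eq_abs, sq_abs] at h
  have h2 : Real.exp |c * z| ≤ Real.exp (z / 8) := by
    rw [abs_mul, abs_of_nonneg hz]
    apply Real.exp_le_exp.2
    nlinarith
  have h3 := le_abs_self (Real.exp (c * z) - (1 + c * z))
  have h4 : (c * z) ^ 2 * Real.exp |c * z| ≤ (c * z) ^ 2 * Real.exp (z / 8) := by gcongr
  nlinarith

variable {m n : ℕ} {u : EuclideanSpace ℝ (Fin n)} {φ : EuclideanSpace ℝ (Fin n) → ℝ} {c : ℝ}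

lemma integrable_of_le_inner_sq (hu : ‖u‖ = 1) (hφ : Measurable φ) (h0 : ∀ a, 0 ≤ φ a)
    (h1 : ∀ a, φ a ≤ ⟪u, a⟫ ^ 2) :
    Integrable φ (stdGaussian (EuclideanSpace ℝ (Fin n))) :=
  (integrable_comp_inner_stdGaussian hu integrable_sq_gaussianReal).mono'
    hφ.aestronglyMeasurable (Filter.Eventually.of_forall fun a => by
      rw [Real.norm_of_nonneg (h0 a)]; exact h1 a)

lemma exp_mul_le_of_le_inner_sq (h0 : ∀ a, 0 ≤ φ a) (h1 : ∀ a, φ a ≤ ⟪u, a⟫ ^ 2)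
    (hc : |c| ≤ 1 / 8) (a : EuclideanSpace ℝ (Fin n)) :
    Real.exp (c * φ a) ≤
      1 + c * φ a + c ^ 2 * (⟪u, a⟫ ^ 4 * Real.exp (⟪u, a⟫ ^ 2 / 8)) := by
  refine (exp_mul_le_of_abs_le hc (h0 a)).trans ?_
  have := h0 a
  have := h1 a
  rw [show ⟪u, a⟫ ^ 4 = (⟪u, a⟫ ^ 2) ^ 2 by ring]
  gcongr

lemma integrable_exp_mul_of_le_inner_sq (hu : ‖u‖ = 1) (hφ : Measurable φ) (h0 : ∀ a, 0 ≤ φ a)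
    (h1 : ∀ a, φ a ≤ ⟪u, a⟫ ^ 2) (hc : |c| ≤ 1 / 8) :
    Integrable (fun a => Real.exp (c * φ a)) (stdGaussian (EuclideanSpace ℝ (Fin n))) := by
  refine (((integrable_const (1 : ℝ)).add ((integrable_of_le_inner_sq hu hφ h0 h1).const_mul c)).add
    ((integrable_comp_inner_stdGaussian hu
      integrable_pow_four_mul_exp_gaussianReal).const_mul (c ^ 2))).mono'
    (by fun_prop) (Filter.Eventually.of_forall fun a => ?_)
  rw [Real.norm_of_nonneg (Real.exp_pos _).le]
  exact exp_mul_le_of_le_inner_sq h0 h1 hc a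

lemma integral_exp_mul_le (hu : ‖u‖ = 1) (hφ : Measurable φ) (h0 : ∀ a, 0 ≤ φ a)
    (h1 : ∀ a, φ a ≤ ⟪u, a⟫ ^ 2) (hc : |c| ≤ 1 / 8) :
    ∫ a, Real.exp (c * φ a) ∂(stdGaussian (EuclideanSpace ℝ (Fin n))) ≤
      Real.exp (c * (∫ a, φ a ∂(stdGaussian (EuclideanSpace ℝ (Fin n)))) + c ^ 2 * mgfConst) := by
  have i1 : Integrable (fun a => 1 + c * φ a) (stdGaussian (EuclideanSpace ℝ (Fin n))) :=
    (integrable_const (1 : ℝ)).add ((integrable_of_le_inner_sq hu hφ h0 h1).const_mul c)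
  have i2 := (integrable_comp_inner_stdGaussian hu
      integrable_pow_four_mul_exp_gaussianReal).const_mul (c ^ 2)
  refine (integral_mono (integrable_exp_mul_of_le_inner_sq hu hφ h0 h1 hc) (i1.add i2)
    (exp_mul_le_of_le_inner_sq h0 h1 hc)).trans ?_
  have e : ∫ a, ((fun a => 1 + c * φ a) +
      fun a => c ^ 2 * (⟪u, a⟫ ^ 4 * Real.exp (⟪u, a⟫ ^ 2 / 8))) a
      ∂(stdGaussian (EuclideanSpace ℝ (Fin n)))
      = 1 + (c * (∫ a, φ a ∂(stdGaussian (EuclideanSpace ℝ (Fin n)))) + c ^ 2 * mgfConst) := by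
    rw [integral_add' i1 i2, integral_add (integrable_const _)
      ((integrable_of_le_inner_sq hu hφ h0 h1).const_mul c), integral_const_mul, integral_const_mul,
      integral_comp_inner_stdGaussian hu (fun x => x ^ 4 * Real.exp (x ^ 2 / 8)) (by fun_prop)]
    simp [mgfConst, add_assoc]
  rw [e, add_comm]
  exact Real.add_one_le_exp _

lemma gaussMatrixReal_real_le_exp (hu : ‖u‖ = 1) (hφ : Measurable φ) (h0 : ∀ a, 0 ≤ φ a)
    (h1 : ∀ a, φ a ≤ ⟪u, a⟫ ^ 2) (hc : |c| ≤ 1 / 8) (s : ℝ) :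
    (gaussMatrixReal m n).real
        {A | m * (c * (∫ a, φ a ∂(stdGaussian (EuclideanSpace ℝ (Fin n)))) + s) ≤
          c * ∑ i, φ (WithLp.toLp 2 (A i))} ≤
      Real.exp (-(m * (s - c ^ 2 * mgfConst))) := by
  set P : Measure (Fin n → ℝ) := Measure.pi fun _ : Fin n => gaussianReal 0 1 with hP
  have hmap : P.map (WithLp.toLp 2) = stdGaussian (EuclideanSpace ℝ (Fin n)) :=
    map_pi_eq_stdGaussian
  have hexp : ∀ A : Fin m → Fin n → ℝ, Real.exp (1 * (c * ∑ i, φ (WithLp.toLp 2 (A i))))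
      = ∏ i, Real.exp (c * φ (WithLp.toLp 2 (A i))) := by
    intro A
    rw [one_mul, Finset.mul_sum, Real.exp_sum]
  have hint : Integrable (fun a : Fin n → ℝ => Real.exp (c * φ (WithLp.toLp 2 a))) P := by
    have := integrable_exp_mul_of_le_inner_sq hu hφ h0 h1 hc
    rw [← hmap] at this
    exact this.comp_measurable (by fun_prop)
  have hval : ∫ a, Real.exp (c * φ (WithLp.toLp 2 a)) ∂P
      = ∫ a, Real.exp (c * φ a) ∂(stdGaussian (EuclideanSpace ℝ (Fin n))) := by
    rw [← hmap, integral_map (by fun_prop) (by fun_prop)]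
  have hmark := measure_ge_le_exp_mul_mgf (μ := gaussMatrixReal m n)
    (X := fun A => c * ∑ i, φ (WithLp.toLp 2 (A i)))
    (m * (c * (∫ a, φ a ∂(stdGaussian (EuclideanSpace ℝ (Fin n)))) + s)) (t := 1) zero_le_one (by
      simp_rw [hexp]
      exact Integrable.fintype_prod (f := fun _ a => Real.exp (c * φ (WithLp.toLp 2 a)))
        fun _ => hint)
  refine hmark.trans ?_
  have hmgf : mgf (fun A : Fin m → Fin n → ℝ => c * ∑ i, φ (WithLp.toLp 2 (A i)))
      (gaussMatrixReal m n) 1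
      = (∫ a, Real.exp (c * φ a) ∂(stdGaussian (EuclideanSpace ℝ (Fin n)))) ^ m := by
    unfold mgf gaussMatrixReal
    simp_rw [hexp]
    rw [integral_fintype_prod_eq_prod (fun (_ : Fin m) (a : Fin n → ℝ) =>
      Real.exp (c * φ (WithLp.toLp 2 a)))]
    simp [← hval, hP]
  rw [hmgf]
  have hle : (∫ a, Real.exp (c * φ a) ∂(stdGaussian (EuclideanSpace ℝ (Fin n)))) ^ m ≤
      Real.exp (c * (∫ a, φ a ∂(stdGaussian (EuclideanSpace ℝ (Fin n)))) + c ^ 2 * mgfConst) ^ m :=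
    pow_le_pow_left₀ (integral_nonneg fun _ => (Real.exp_pos _).le)
      (integral_exp_mul_le hu hφ h0 h1 hc) m
  rw [← Real.exp_nat_mul] at hle
  refine (mul_le_mul_of_nonneg_left hle (Real.exp_pos _).le).trans ?_
  rw [← Real.exp_add]
  apply Real.exp_le_exp.2
  apply le_of_eq
  ring

/-- Exponential concentration with a rate that does not depend on the function or the dimension. -/
lemma exists_concentration_rate {t : ℝ} (ht : 0 < t) :
    ∃ c₁ : ℝ, 0 < c₁ ∧ ∀ (m n : ℕ) (u : EuclideanSpace ℝ (Fin n))
      (φ : EuclideanSpace ℝ (Fin n) → ℝ), ‖u‖ = 1 → Measurable φ → (∀ a, 0 ≤ φ a) →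
      (∀ a, φ a ≤ ⟪u, a⟫ ^ 2) →
      (gaussMatrixReal m n).real {A | m * ((∫ a, φ a ∂(stdGaussian (EuclideanSpace ℝ (Fin n)))) + t)
        ≤ ∑ i, φ (WithLp.toLp 2 (A i))} ≤ Real.exp (-(c₁ * m)) ∧
      (gaussMatrixReal m n).real {A | ∑ i, φ (WithLp.toLp 2 (A i)) ≤
        m * ((∫ a, φ a ∂(stdGaussian (EuclideanSpace ℝ (Fin n)))) - t)} ≤
          Real.exp (-(c₁ * m)) := by
  have hK := mgfConst_nonneg
  set l : ℝ := min (1 / 8) (t / (2 * (mgfConst + 1))) with hl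
  have hl0 : 0 < l := lt_min (by norm_num) (by positivity)
  have hl8 : |l| ≤ 1 / 8 := by rw [abs_of_pos hl0]; exact min_le_left _ _
  have hlt : l * mgfConst ≤ t / 2 := by
    have h : l ≤ t / (2 * (mgfConst + 1)) := min_le_right _ _
    rw [le_div_iff₀ (by positivity)] at h
    nlinarith
  have hrate : l * t / 2 ≤ l * t - l ^ 2 * mgfConst := by nlinarith
  have hexp : ∀ m : ℕ, Real.exp (-(m * (l * t - l ^ 2 * mgfConst))) ≤
      Real.exp (-(l * t / 2 * m)) := by
    intro m
    apply Real.exp_le_exp.2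
    have := mul_le_mul_of_nonneg_left hrate (Nat.cast_nonneg' (α := ℝ) m)
    linarith
  refine ⟨l * t / 2, by positivity, fun m n u φ hu hφ h0 h1 => ⟨?_, ?_⟩⟩
  · refine (measureReal_mono fun A hA => ?_).trans
      ((gaussMatrixReal_real_le_exp (m := m) hu hφ h0 h1 hl8 (l * t)).trans (hexp m))
    have := mul_le_mul_of_nonneg_left (Set.mem_ofPred_eq ▸ hA) hl0.le
    simp only [Set.mem_ofPred_eq]
    linarith
  · refine (measureReal_mono fun A hA => ?_).trans
      ((gaussMatrixReal_real_le_exp (m := m) hu hφ h0 h1 (c := -l) (by rwa [abs_neg])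
        (l * t)).trans (by rw [neg_sq]; exact hexp m))
    have := mul_le_mul_of_nonneg_left (Set.mem_ofPred_eq ▸ hA) hl0.le
    simp only [Set.mem_ofPred_eq]
    linarith

end Chernoff

section Nets

open Module

variable {E : Type*} [NormedAddCommGroup E] [NormedSpace ℝ E]

lemma card_le_of_separated_unit [FiniteDimensional ℝ E] {ε : ℝ} (hε : 0 < ε) (s : Finset E)
    (hs : ∀ c ∈ s, ‖c‖ = 1) (h : ∀ c ∈ s, ∀ d ∈ s, c ≠ d → ε ≤ ‖c - d‖) :
    (s.card : ℝ) ≤ (1 + 2 / ε) ^ finrank ℝ E := by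
  borelize E
  let μ : Measure E := Measure.addHaar
  have hδ : 0 < ε / 2 := by positivity
  have hρ : 0 < 1 + ε / 2 := by positivity
  have hdisj : Set.Pairwise (s : Set E)
      (Function.onFun Disjoint fun c => Metric.ball (c : E) (ε / 2)) := by
    rintro c hc d hd hcd
    apply Metric.ball_disjoint_ball
    rw [dist_eq_norm, add_halves]
    exact h c hc d hd hcd
  have hsub : (⋃ c ∈ s, Metric.ball (c : E) (ε / 2)) ⊆ Metric.ball (0 : E) (1 + ε / 2) := by
    refine Set.iUnion₂_subset fun x hx => ?_
    apply Metric.ball_subset_ball'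
    rw [dist_zero_right, hs x hx, add_comm]
  have hvol : (s.card : ENNReal) * ENNReal.ofReal ((ε / 2) ^ finrank ℝ E) * μ (Metric.ball 0 1) ≤
      ENNReal.ofReal ((1 + ε / 2) ^ finrank ℝ E) * μ (Metric.ball 0 1) :=
    calc
      _ = μ (⋃ c ∈ s, Metric.ball (c : E) (ε / 2)) := by
        rw [measure_biUnion_finset hdisj fun c _ => measurableSet_ball]
        simp only [μ.addHaar_ball_of_pos _ hδ, Finset.sum_const, nsmul_eq_mul, mul_assoc]
      _ ≤ μ (Metric.ball (0 : E) (1 + ε / 2)) := measure_mono hsub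
      _ = _ := by simp only [μ.addHaar_ball_of_pos _ hρ]
  have hcard : (s.card : ENNReal) * ENNReal.ofReal ((ε / 2) ^ finrank ℝ E) ≤
      ENNReal.ofReal ((1 + ε / 2) ^ finrank ℝ E) :=
    (ENNReal.mul_le_mul_iff_left (Metric.measure_ball_pos _ _ zero_lt_one).ne'
      measure_ball_lt_top.ne).1 hvol
  have h3 := ENNReal.toReal_le_of_le_ofReal (pow_nonneg hρ.le _) hcard
  rw [ENNReal.toReal_mul, ENNReal.toReal_natCast, ENNReal.toReal_ofReal (by positivity),
    ← le_div_iff₀ (by positivity), ← div_pow] at h3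
  have e : (1 + ε / 2) / (ε / 2) = 1 + 2 / ε := by
    field_simp
    ring
  rwa [e] at h3

lemma exists_unit_net [FiniteDimensional ℝ E] {ε : ℝ} (hε : 0 < ε) :
    ∃ N : Finset E, (∀ x ∈ N, ‖x‖ = 1) ∧ (N.card : ℝ) ≤ (1 + 2 / ε) ^ finrank ℝ E ∧
      ∀ x : E, ‖x‖ = 1 → ∃ y ∈ N, ‖x - y‖ ≤ ε := by
  classical
  let p : ℕ → Prop := fun k => ∃ s : Finset E, (∀ c ∈ s, ‖c‖ = 1) ∧
    (∀ c ∈ s, ∀ d ∈ s, c ≠ d → ε ≤ ‖c - d‖) ∧ s.card = k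
  have hbound : ∀ k, p k → k ≤ ⌊(1 + 2 / ε) ^ finrank ℝ E⌋₊ := by
    rintro k ⟨s, h1, h2, rfl⟩
    exact Nat.le_floor (card_le_of_separated_unit hε s h1 h2)
  have hp0 : p 0 := ⟨∅, by simp, by simp, by simp⟩
  obtain ⟨N, h1, h2, h3⟩ := Nat.findGreatest_spec (P := p) (Nat.zero_le _) hp0
  refine ⟨N, h1, card_le_of_separated_unit hε N h1 h2, fun x hx => ?_⟩
  by_contra! hcon
  have hxN : x ∉ N := fun hmem => by
    have := hcon x hmem
    rw [sub_self, norm_zero] at this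
    linarith
  have hp : p (N.card + 1) := by
    refine ⟨insert x N, ?_, ?_, Finset.card_insert_of_notMem hxN⟩
    · simpa [hx] using h1
    · intro c hc d hd hcd
      rw [Finset.mem_insert] at hc hd
      rcases hc with rfl | hc <;> rcases hd with rfl | hd
      · exact absurd rfl hcd
      · exact (hcon d hd).le
      · rw [norm_sub_rev]
        exact (hcon c hc).le
      · exact h2 c hc d hd hcd
  have := Nat.le_findGreatest (hbound _ hp) hp
  rw [← h3] at this
  exact Nat.not_succ_le_self _ this

variable {F : Type*} [NormedAddCommGroup F] [NormedSpace ℝ F]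

lemma opNorm_le_of_unit_net {N : Finset E} {ε B : ℝ} (hε : 0 ≤ ε) (hB : 0 ≤ B)
    (hN : ∀ x : E, ‖x‖ = 1 → ∃ y ∈ N, ‖x - y‖ ≤ ε) (G : E →L[ℝ] F) (hG : ∀ y ∈ N, ‖G y‖ ≤ B) :
    (1 - ε) * ‖G‖ ≤ B := by
  have : ‖G‖ ≤ B + ‖G‖ * ε := by
    refine ContinuousLinearMap.opNorm_le_of_unit_norm (by positivity) fun x hx => ?_
    obtain ⟨y, hy, hxy⟩ := hN x hx
    calc ‖G x‖ = ‖G y + G (x - y)‖ := by rw [← map_add, add_sub_cancel]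
      _ ≤ ‖G y‖ + ‖G (x - y)‖ := norm_add_le _ _
      _ ≤ B + ‖G‖ * ε := add_le_add (hG y hy) (G.le_opNorm_of_le hxy)
  linarith

end Nets

section MinAbs

variable {m : ℕ}

/-- The entrywise minimum of the absolute values of two vectors. -/
noncomputable def minAbs (a b : EuclideanSpace ℝ (Fin m)) : EuclideanSpace ℝ (Fin m) :=
  WithLp.toLp 2 fun i => min |a i| |b i|

lemma norm_minAbs_sq (a b : EuclideanSpace ℝ (Fin m)) :
    ‖minAbs a b‖ ^ 2 = ∑ i, min (a i ^ 2) (b i ^ 2) := by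
  rw [EuclideanSpace.real_norm_sq_eq]
  refine Finset.sum_congr rfl fun i _ => ?_
  change (min |a i| |b i|) ^ 2 = _
  rcases le_total |a i| |b i| with h | h
  · rw [min_eq_left h, min_eq_left (sq_le_sq.2 h), sq_abs]
  · rw [min_eq_right h, min_eq_right (sq_le_sq.2 h), sq_abs]

lemma norm_le_norm_of_abs_le {a b : EuclideanSpace ℝ (Fin m)} (h : ∀ i, |a i| ≤ |b i|) :
    ‖a‖ ≤ ‖b‖ := by
  apply le_of_sq_le_sq _ (norm_nonneg _)
  rw [EuclideanSpace.real_norm_sq_eq, EuclideanSpace.real_norm_sq_eq]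
  exact Finset.sum_le_sum fun i _ => sq_le_sq.2 (h i)

lemma abs_minAbs_apply (a b : EuclideanSpace ℝ (Fin m)) (i : Fin m) :
    |minAbs a b i| = min |a i| |b i| :=
  abs_of_nonneg (le_min (abs_nonneg _) (abs_nonneg _))

lemma norm_minAbs_le_left (a b : EuclideanSpace ℝ (Fin m)) : ‖minAbs a b‖ ≤ ‖a‖ :=
  norm_le_norm_of_abs_le fun i => by rw [abs_minAbs_apply]; exact min_le_left _ _

lemma minAbs_comm (a b : EuclideanSpace ℝ (Fin m)) : minAbs a b = minAbs b a := by
  simp [minAbs, min_comm]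

lemma norm_minAbs_smul_right_le (a b : EuclideanSpace ℝ (Fin m)) {c : ℝ} (hc : |c| ≤ 1) :
    ‖minAbs a (c • b)‖ ≤ ‖minAbs a b‖ :=
  norm_le_norm_of_abs_le fun i => by
    rw [abs_minAbs_apply, abs_minAbs_apply]
    refine min_le_min_left _ ?_
    rw [PiLp.smul_apply, smul_eq_mul, abs_mul]
    exact mul_le_of_le_one_left (abs_nonneg _) hc

lemma norm_minAbs_smul (a b : EuclideanSpace ℝ (Fin m)) (c : ℝ) :
    ‖minAbs (c • a) (c • b)‖ = |c| * ‖minAbs a b‖ := by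
  rw [← Real.norm_eq_abs, ← norm_smul]
  have h : ∀ i, |minAbs (c • a) (c • b) i| = |(c • minAbs a b) i| := fun i => by
    rw [PiLp.smul_apply, smul_eq_mul, abs_mul, abs_minAbs_apply, abs_minAbs_apply,
      mul_min_of_nonneg _ _ (abs_nonneg c)]
    simp [abs_mul]
  exact le_antisymm (norm_le_norm_of_abs_le fun i => (h i).le)
    (norm_le_norm_of_abs_le fun i => (h i).ge)

lemma norm_minAbs_le_add (a b a' b' : EuclideanSpace ℝ (Fin m)) :
    ‖minAbs a b‖ ≤ ‖minAbs a' b'‖ + (‖a - a'‖ + ‖b - b'‖) := by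
  have h : ‖minAbs a b - minAbs a' b'‖ ≤ ‖a - a'‖ + ‖b - b'‖ := by
    apply le_of_sq_le_sq _ (by positivity)
    have h1 : ‖minAbs a b - minAbs a' b'‖ ^ 2 ≤ ‖a - a'‖ ^ 2 + ‖b - b'‖ ^ 2 := by
      simp only [EuclideanSpace.real_norm_sq_eq]
      rw [← Finset.sum_add_distrib]
      refine Finset.sum_le_sum fun i _ => ?_
      have h2 : |min |a i| |b i| - min |a' i| (|b' i|)| ≤ max |(a - a') i| |(b - b') i| :=
        (abs_min_sub_min_le_max _ _ _ _).trans
          (max_le_max (abs_abs_sub_abs_le _ _) (abs_abs_sub_abs_le _ _))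
      change (min |a i| |b i| - min |a' i| |b' i|) ^ 2 ≤ _
      rw [← sq_abs, ← sq_abs ((a - a') i), ← sq_abs ((b - b') i)]
      have h3 := abs_nonneg (min |a i| |b i| - min |a' i| |b' i|)
      rcases le_max_iff.1 h2 with h2 | h2
      · nlinarith [sq_nonneg |(b - b') i|]
      · nlinarith [sq_nonneg |(a - a') i|]
    nlinarith [norm_nonneg (a - a'), norm_nonneg (b - b')]
  have := norm_add_le (minAbs a' b') (minAbs a b - minAbs a' b')
  rw [add_sub_cancel] at this
  linarith

variable {E : Type*} [NormedAddCommGroup E] [NormedSpace ℝ E]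

/-- Lower bounds for `‖minAbs (G u) (G v)‖` on unit vectors extend to all vectors. -/
lemma mul_min_norm_le_norm_minAbs {G : E →L[ℝ] EuclideanSpace ℝ (Fin m)} {L : ℝ}
    (h : ∀ u v : E, ‖u‖ = 1 → ‖v‖ = 1 → L ≤ ‖minAbs (G u) (G v)‖) (u v : E) :
    L * min ‖u‖ ‖v‖ ≤ ‖minAbs (G u) (G v)‖ := by
  wlog huv : ‖u‖ ≤ ‖v‖ generalizing u v
  · rw [min_comm, minAbs_comm]
    exact this v u (le_of_not_ge huv)
  rw [min_eq_left huv]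
  rcases (norm_nonneg u).eq_or_lt with hu | hu
  · rw [← hu, mul_zero]
    exact norm_nonneg _
  have hv : 0 < ‖v‖ := hu.trans_le huv
  have h1 := h (‖u‖⁻¹ • u) (‖v‖⁻¹ • v)
    (by rw [norm_smul, norm_inv, norm_norm, inv_mul_cancel₀ hu.ne'])
    (by rw [norm_smul, norm_inv, norm_norm, inv_mul_cancel₀ hv.ne'])
  calc L * ‖u‖ ≤ |‖u‖| * ‖minAbs (G (‖u‖⁻¹ • u)) (G (‖v‖⁻¹ • v))‖ := by
        rw [abs_norm, mul_comm]
        gcongr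
    _ = ‖minAbs (G u) ((‖u‖ * ‖v‖⁻¹) • G v)‖ := by
        rw [← norm_minAbs_smul, map_smul, map_smul, smul_smul, smul_smul, mul_inv_cancel₀ hu.ne',
          one_smul]
    _ ≤ ‖minAbs (G u) (G v)‖ := by
        apply norm_minAbs_smul_right_le
        rw [← div_eq_mul_inv, abs_of_nonneg (by positivity)]
        exact div_le_one_of_le₀ huv hv.le

lemma norm_minAbs_ge_of_unit_net {N : Finset E} {ε B M : ℝ}
    (hN : ∀ x : E, ‖x‖ = 1 → ∃ y ∈ N, ‖x - y‖ ≤ ε) (G : E →L[ℝ] EuclideanSpace ℝ (Fin m))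
    (hM : ‖G‖ ≤ M) (hG : ∀ u ∈ N, ∀ v ∈ N, B ≤ ‖minAbs (G u) (G v)‖) (u v : E)
    (hu : ‖u‖ = 1) (hv : ‖v‖ = 1) :
    B - 2 * (M * ε) ≤ ‖minAbs (G u) (G v)‖ := by
  obtain ⟨u', hu', hd⟩ := hN u hu
  obtain ⟨v', hv', hd'⟩ := hN v hv
  have h1 := norm_minAbs_le_add (G u') (G v') (G u) (G v)
  have h2 : ‖G u' - G u‖ ≤ M * ε := by
    rw [← map_sub]
    exact (G.le_of_opNorm_le_of_le hM (by rwa [norm_sub_rev]))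
  have h3 : ‖G v' - G v‖ ≤ M * ε := by
    rw [← map_sub]
    exact (G.le_of_opNorm_le_of_le hM (by rwa [norm_sub_rev]))
  have := hG u' hu' v' hv'
  linarith

end MinAbs

section Constants

lemma sqrt_pi_div_eq_inv : √(π / (π - 2)) = (√(1 - 2 / π))⁻¹ := by
  rw [← Real.sqrt_inv]
  congr 1
  have := Real.pi_gt_three
  field_simp

lemma sqrt_one_sub_two_div_pi_mem : 0.6 ≤ √(1 - 2 / π) ∧ √(1 - 2 / π) ≤ 0.61 := by
  have h1 := Real.pi_gt_d2
  have h2 := Real.pi_lt_d2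
  have hpos := Real.pi_pos
  constructor
  · apply Real.le_sqrt_of_sq_le
    rw [le_sub_comm, div_le_iff₀ hpos]
    norm_num
    linarith
  · rw [Real.sqrt_le_left (by norm_num), sub_le_comm, le_div_iff₀ hpos]
    norm_num
    linarith

lemma lower_constant_le :
    1.001 / (√(π / (π - 2)) + 0.01) ≤ √(1 - 2 / π - 0.0001) - 2 * (1.001 * 0.0001) := by
  rw [sqrt_pi_div_eq_inv]
  obtain ⟨h1, h2⟩ := sqrt_one_sub_two_div_pi_mem
  have hsq : √(1 - 2 / π) ^ 2 = 1 - 2 / π := Real.sq_sqrt (by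
    have := Real.pi_gt_three
    rw [sub_nonneg, div_le_one (by linarith)]
    linarith)
  rw [show √(1 - 2 / π - 0.0001) = √(√(1 - 2 / π) ^ 2 - 0.0001) by rw [hsq]]
  generalize √(1 - 2 / π) = w at h1 h2
  have h3 : w - 0.0002 ≤ √(w ^ 2 - 0.0001) := by
    apply Real.le_sqrt_of_sq_le
    nlinarith
  have hw : 0 < w := by linarith
  refine le_trans ?_ (sub_le_sub_right h3 _)
  have : w⁻¹ + 0.01 = (1 + 0.01 * w) / w := by field_simp
  rw [this, div_div_eq_mul_div, div_le_iff₀ (by positivity)]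
  nlinarith

end Constants

section UniformBounds

open scoped RealInnerProductSpace
open Module

variable {m n : ℕ}

/-- The linear map `x ↦ A x` between Euclidean spaces. -/
noncomputable def rowMap (A : Fin m → Fin n → ℝ) :
    EuclideanSpace ℝ (Fin n) →L[ℝ] EuclideanSpace ℝ (Fin m) :=
  (PiLp.continuousLinearEquiv 2 ℝ (fun _ : Fin m => ℝ)).symm.toContinuousLinearMap ∘L
    ContinuousLinearMap.pi fun i => innerSL ℝ (WithLp.toLp 2 (A i))

lemma rowMap_apply (A : Fin m → Fin n → ℝ) (x : EuclideanSpace ℝ (Fin n)) (i : Fin m) :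
    rowMap A x i = ⟪x, WithLp.toLp 2 (A i)⟫ := by
  rw [real_inner_comm]
  rfl

lemma rowMap_apply_eq_sum (A : Fin m → Fin n → ℝ) (x : EuclideanSpace ℝ (Fin n)) (i : Fin m) :
    rowMap A x i = ∑ j, A i j * x j := by
  rw [rowMap_apply]
  simp [PiLp.inner_apply]

/-- The subspace of vectors supported in `T`. -/
def coordSubspace (T : Finset (Fin n)) : Submodule ℝ (EuclideanSpace ℝ (Fin n)) where
  carrier := {x | ∀ i, i ∉ T → x i = 0}
  add_mem' hx hy i hi := by simp [hx i hi, hy i hi]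
  zero_mem' i _ := by simp
  smul_mem' c x hx i hi := by simp [hx i hi]

lemma finrank_coordSubspace_le (T : Finset (Fin n)) : finrank ℝ (coordSubspace T) ≤ T.card := by
  let f : coordSubspace T →ₗ[ℝ] (T → ℝ) :=
    { toFun := fun x i => (x : EuclideanSpace ℝ (Fin n)) i
      map_add' := fun x y => by ext i; simp
      map_smul' := fun c x => by ext i; simp }
  have hf : Function.Injective f := by
    intro x y hxy
    ext i
    by_cases hi : i ∈ T
    · exact congrFun hxy ⟨i, hi⟩
    · rw [x.2 i hi, y.2 i hi]
  simpa using LinearMap.finrank_le_finrank_of_injective hf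

/-- Two-sided bounds for `A` on the subspace of vectors supported in `T`. -/
def UniformBounds (A : Fin m → Fin n → ℝ) (T : Finset (Fin n)) : Prop :=
  ∀ u ∈ coordSubspace T, ∀ v ∈ coordSubspace T,
    ‖rowMap A u‖ ≤ √m * 1.001 * ‖u‖ ∧
    √m * (1.001 / (√(π / (π - 2)) + 0.01)) * min ‖u‖ ‖v‖ ≤ ‖minAbs (rowMap A u) (rowMap A v)‖

lemma uniformBounds_of_net {A : Fin m → Fin n → ℝ} {T : Finset (Fin n)}
    {N : Finset (coordSubspace T)}
    (hN : ∀ x : coordSubspace T, ‖x‖ = 1 → ∃ y ∈ N, ‖x - y‖ ≤ 0.0001)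
    (hup : ∀ u ∈ N, ∑ i, ⟪(u : EuclideanSpace ℝ (Fin n)), WithLp.toLp 2 (A i)⟫ ^ 2
      ≤ m * (1 + 0.0001))
    (hlo : ∀ u ∈ N, ∀ v ∈ N, m * (1 - 2 / π - 0.0001) ≤
      ∑ i, min (⟪(u : EuclideanSpace ℝ (Fin n)), WithLp.toLp 2 (A i)⟫ ^ 2)
        (⟪(v : EuclideanSpace ℝ (Fin n)), WithLp.toLp 2 (A i)⟫ ^ 2)) :
    UniformBounds A T := by
  set G : coordSubspace T →L[ℝ] EuclideanSpace ℝ (Fin m) := rowMap A ∘L (coordSubspace T).subtypeL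
    with hG
  have hGi : ∀ (u : coordSubspace T) (i : Fin m),
      G u i = ⟪(u : EuclideanSpace ℝ (Fin n)), WithLp.toLp 2 (A i)⟫ := fun u i =>
    rowMap_apply A u i
  have hm0 : 0 ≤ √(m : ℝ) := Real.sqrt_nonneg _
  have hGnorm : ‖G‖ ≤ √m * 1.001 := by
    have h := opNorm_le_of_unit_net (ε := 0.0001) (B := √m * (1 + 0.0001)) (by norm_num)
      (by positivity) hN G fun y hy => by
        apply le_of_sq_le_sq _ (by positivity)
        rw [EuclideanSpace.real_norm_sq_eq, mul_pow, Real.sq_sqrt (Nat.cast_nonneg' m)]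
        simp_rw [hGi]
        refine (hup y hy).trans ?_
        gcongr
        norm_num
    nlinarith
  have hGmin : ∀ u ∈ N, ∀ v ∈ N, √m * √(1 - 2 / π - 0.0001) ≤ ‖minAbs (G u) (G v)‖ := by
    intro u hu v hv
    rw [← Real.sqrt_mul (Nat.cast_nonneg' m)]
    apply Real.sqrt_le_iff.2 ⟨norm_nonneg _, ?_⟩
    rw [norm_minAbs_sq]
    simp_rw [hGi]
    exact hlo u hu v hv
  have hGunit : ∀ u v : coordSubspace T, ‖u‖ = 1 → ‖v‖ = 1 →
      √m * (1.001 / (√(π / (π - 2)) + 0.01)) ≤ ‖minAbs (G u) (G v)‖ := by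
    intro u v hu hv
    refine le_trans ?_ (norm_minAbs_ge_of_unit_net hN G hGnorm hGmin u v hu hv)
    have := mul_le_mul_of_nonneg_left lower_constant_le hm0
    linarith
  intro u hu v hv
  exact ⟨G.le_of_opNorm_le hGnorm ⟨u, hu⟩,
    mul_min_norm_le_norm_minAbs hGunit ⟨u, hu⟩ ⟨v, hv⟩⟩

lemma exists_uniformBounds_rate : ∃ c₁ : ℝ, 0 < c₁ ∧ ∀ (m n : ℕ) (T : Finset (Fin n)),
    (gaussMatrixReal m n).real {A | ¬ UniformBounds A T} ≤
      2 * 20001 ^ (2 * T.card) * Real.exp (-(c₁ * m)) := by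
  obtain ⟨c₁, hc₁, hconc⟩ := exists_concentration_rate (t := 0.0001) (by norm_num)
  refine ⟨c₁, hc₁, fun m n T => ?_⟩
  obtain ⟨N, hN1, hNcard, hN⟩ := exists_unit_net (E := coordSubspace T) (ε := 0.0001) (by norm_num)
  have hNcard' : (N.card : ℝ) ≤ 20001 ^ T.card := by
    refine hNcard.trans ?_
    norm_num
    exact pow_le_pow_right₀ (by norm_num) (finrank_coordSubspace_le T)
  let up : coordSubspace T → Set (Fin m → Fin n → ℝ) := fun u =>
    {A | m * (1 + 0.0001) ≤ ∑ i, ⟪(u : EuclideanSpace ℝ (Fin n)), WithLp.toLp 2 (A i)⟫ ^ 2}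
  let lo : coordSubspace T × coordSubspace T → Set (Fin m → Fin n → ℝ) := fun w =>
    {A | ∑ i, min (⟪(w.1 : EuclideanSpace ℝ (Fin n)), WithLp.toLp 2 (A i)⟫ ^ 2)
        (⟪(w.2 : EuclideanSpace ℝ (Fin n)), WithLp.toLp 2 (A i)⟫ ^ 2) ≤ m * (1 - 2 / π - 0.0001)}
  have hsub : {A : Fin m → Fin n → ℝ | ¬ UniformBounds A T} ⊆
      (⋃ u ∈ N, up u) ∪ ⋃ w ∈ N ×ˢ N, lo w := by
    intro A hA
    by_contra hcon
    simp only [Set.mem_union, Set.mem_iUnion, not_or, not_exists, up, lo, Set.mem_ofPred_eq,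
      not_le] at hcon
    exact hA (uniformBounds_of_net hN (fun u hu => (hcon.1 u hu).le)
      fun u hu v hv => (hcon.2 (u, v) (Finset.mk_mem_product hu hv)).le)
  have hup : ∀ u ∈ N, (gaussMatrixReal m n).real (up u) ≤ Real.exp (-(c₁ * m)) := by
    intro u hu
    have hu1 : ‖(u : EuclideanSpace ℝ (Fin n))‖ = 1 := hN1 u hu
    have h := (hconc m n u (fun a => ⟪(u : EuclideanSpace ℝ (Fin n)), a⟫ ^ 2) hu1 (by fun_prop)
      (fun a => sq_nonneg _) fun a => le_rfl).1
    rwa [integral_comp_inner_stdGaussian hu1 (fun x => x ^ 2) (by fun_prop),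
      integral_sq_gaussianReal_zero_one] at h
  have hlo : ∀ w ∈ N ×ˢ N, (gaussMatrixReal m n).real (lo w) ≤ Real.exp (-(c₁ * m)) := by
    intro w hw
    rw [Finset.mem_product] at hw
    have hu1 : ‖(w.1 : EuclideanSpace ℝ (Fin n))‖ = 1 := hN1 _ hw.1
    have hv1 : ‖(w.2 : EuclideanSpace ℝ (Fin n))‖ = 1 := hN1 _ hw.2
    have h := (hconc m n w.1 (fun a => min (⟪(w.1 : EuclideanSpace ℝ (Fin n)), a⟫ ^ 2)
      (⟪(w.2 : EuclideanSpace ℝ (Fin n)), a⟫ ^ 2)) hu1 (by fun_prop)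
      (fun a => le_min (sq_nonneg _) (sq_nonneg _)) fun a => min_le_left _ _).2
    refine (measureReal_mono fun A hA => ?_).trans h
    refine le_trans (Set.mem_ofPred_eq ▸ hA) ?_
    have := le_integral_min_sq_stdGaussian hu1 hv1
    gcongr
  calc (gaussMatrixReal m n).real {A | ¬ UniformBounds A T}
      ≤ (gaussMatrixReal m n).real (⋃ u ∈ N, up u)
        + (gaussMatrixReal m n).real (⋃ w ∈ N ×ˢ N, lo w) :=
        (measureReal_mono hsub).trans (measureReal_union_le _ _)
    _ ≤ (∑ u ∈ N, (gaussMatrixReal m n).real (up u))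
        + ∑ w ∈ N ×ˢ N, (gaussMatrixReal m n).real (lo w) :=
        add_le_add (measureReal_biUnion_finset_le _ _) (measureReal_biUnion_finset_le _ _)
    _ ≤ N.card * Real.exp (-(c₁ * m)) + (N.card * N.card) * Real.exp (-(c₁ * m)) := by
        refine add_le_add ((Finset.sum_le_sum hup).trans ?_) ((Finset.sum_le_sum hlo).trans ?_)
        · simp
        · simp
    _ ≤ 2 * 20001 ^ (2 * T.card) * Real.exp (-(c₁ * m)) := by
        rw [← add_mul]
        gcongr
        have h1 : (1 : ℝ) ≤ 20001 ^ T.card := one_le_pow₀ (by norm_num)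
        have h2 : (N.card : ℝ) * N.card ≤ 20001 ^ T.card * 20001 ^ T.card := by gcongr
        rw [mul_comm 2 T.card, pow_mul]
        nlinarith

end UniformBounds

section Sparse

variable {m n : ℕ}

lemma lpNorm_two_eq_norm_s7 {ι : Type*} [Fintype ι] (x : ι → ℝ) :
    lpNorm 2 x = ‖(WithLp.toLp 2 x : EuclideanSpace ℝ ι)‖ := by
  rw [EuclideanSpace.norm_eq, Real.sqrt_eq_rpow]
  simp [_root_.lpNorm]

lemma phaseDist_two_eq_min (x y : Fin n → ℝ) :
    phaseDist 2 x y = min ‖(WithLp.toLp 2 x - WithLp.toLp 2 y : EuclideanSpace ℝ (Fin n))‖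
      ‖(WithLp.toLp 2 x + WithLp.toLp 2 y : EuclideanSpace ℝ (Fin n))‖ := by
  have h : {d | ∃ c : ℝ, ‖c‖ = 1 ∧ d = lpNorm 2 (fun i => x i - c * y i)} =
      {‖(WithLp.toLp 2 x - WithLp.toLp 2 y : EuclideanSpace ℝ (Fin n))‖,
        ‖(WithLp.toLp 2 x + WithLp.toLp 2 y : EuclideanSpace ℝ (Fin n))‖} := by
    have h1 : lpNorm 2 (fun i => x i - 1 * y i)
        = ‖(WithLp.toLp 2 x - WithLp.toLp 2 y : EuclideanSpace ℝ (Fin n))‖ := by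
      rw [lpNorm_two_eq_norm_s7, ← WithLp.toLp_sub]
      simp only [one_mul]
      rfl
    have h2 : lpNorm 2 (fun i => x i - -1 * y i)
        = ‖(WithLp.toLp 2 x + WithLp.toLp 2 y : EuclideanSpace ℝ (Fin n))‖ := by
      rw [lpNorm_two_eq_norm_s7, ← WithLp.toLp_add]
      simp only [neg_mul, one_mul, sub_neg_eq_add]
      rfl
    ext d
    simp only [Set.mem_ofPred_eq, Set.mem_insert_iff, Set.mem_singleton_iff, ← h1, ← h2,
      Real.norm_eq_abs]
    constructor
    · rintro ⟨c, hc, rfl⟩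
      rcases eq_or_eq_neg_of_abs_eq hc with rfl | rfl
      · exact Or.inl rfl
      · exact Or.inr rfl
    · rintro (rfl | rfl)
      · exact ⟨1, by simp, rfl⟩
      · exact ⟨-1, by simp, rfl⟩
  rw [phaseDist, h, csInf_pair]

lemma abs_abs_sub_abs_eq_min (a b : ℝ) : |(|a| - |b|)| = min |a - b| |a + b| := by
  rcases le_total 0 a with ha | ha <;> rcases le_total 0 b with hb | hb
  all_goals
    simp only [abs_of_nonneg, abs_of_nonpos, ha, hb]
    grind

lemma lpNorm_absMv_sub (A : Fin m → Fin n → ℝ) (x y : Fin n → ℝ) :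
    lpNorm 2 (fun i => absMv A x i - absMv A y i) =
      ‖minAbs (rowMap A (WithLp.toLp 2 x - WithLp.toLp 2 y))
        (rowMap A (WithLp.toLp 2 x + WithLp.toLp 2 y))‖ := by
  rw [lpNorm_two_eq_norm_s7]
  have h : ∀ i, |absMv A x i - absMv A y i| =
      |minAbs (rowMap A (WithLp.toLp 2 x - WithLp.toLp 2 y))
        (rowMap A (WithLp.toLp 2 x + WithLp.toLp 2 y)) i| := by
    intro i
    rw [abs_minAbs_apply, map_sub, map_add, PiLp.sub_apply, PiLp.add_apply,
      ← abs_abs_sub_abs_eq_min, rowMap_apply_eq_sum, rowMap_apply_eq_sum]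
    rfl
  exact le_antisymm (norm_le_norm_of_abs_le fun i => (h i).le)
    (norm_le_norm_of_abs_le fun i => (h i).ge)

lemma phaselessBiLip_of_uniformBounds {A : Fin m → Fin n → ℝ} {b : ℝ}
    (hA : ∀ T : Finset (Fin n), (T.card : ℝ) ≤ 2 * b → UniformBounds A T) :
    PhaselessBiLip A {z : Fin n → ℝ | (l0Norm z : ℝ) ≤ b}
      (√m * (1.001 / (√(π / (π - 2)) + 0.01))) (√m * 1.001) := by
  classical
  intro x hx y hy
  have hx' : (l0Norm x : ℝ) ≤ b := hx
  have hy' : (l0Norm y : ℝ) ≤ b := hy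
  let T : Finset (Fin n) := (Finset.univ.filter fun i => x i ≠ 0) ∪
    Finset.univ.filter fun i => y i ≠ 0
  have hT : (T.card : ℝ) ≤ 2 * b := by
    have h1 : (T.card : ℝ) ≤ l0Norm x + l0Norm y := by
      have := Finset.card_union_le (Finset.univ.filter fun i => x i ≠ 0)
        (Finset.univ.filter fun i => y i ≠ 0)
      unfold l0Norm
      exact_mod_cast (by convert this)
    linarith
  have hxT : WithLp.toLp 2 x ∈ coordSubspace T := fun i hi => by
    by_contra h
    exact hi (by simp only [T, Finset.mem_union, Finset.mem_filter_univ]; exact Or.inl h)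
  have hyT : WithLp.toLp 2 y ∈ coordSubspace T := fun i hi => by
    by_contra h
    exact hi (by simp only [T, Finset.mem_union, Finset.mem_filter_univ]; exact Or.inr h)
  have hs := sub_mem hxT hyT
  have ha := add_mem hxT hyT
  rw [phaseDist_two_eq_min, lpNorm_absMv_sub]
  refine ⟨(hA T hT _ hs _ ha).2, ?_⟩
  rw [mul_min_of_nonneg _ _ (by positivity)]
  refine le_min ((norm_minAbs_le_left _ _).trans (hA T hT _ hs _ ha).1) ?_
  rw [minAbs_comm]
  exact (norm_minAbs_le_left _ _).trans (hA T hT _ ha _ hs).1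

lemma card_filter_card_le {k s : ℕ} (hk : 0 < k) (hkn : k ≤ n) :
    (((Finset.univ : Finset (Finset (Fin n))).filter fun T => T.card ≤ s).card : ℝ) ≤
      Real.exp (s * Real.log (n / k) + k) := by
  have hk' : (0 : ℝ) < k := by exact_mod_cast hk
  have hkn' : (k : ℝ) ≤ n := by exact_mod_cast hkn
  have hn' : (0 : ℝ) < n := hk'.trans_le hkn'
  have hq : 1 ≤ (n : ℝ) / k := (one_le_div hk').2 hkn'
  have hterm : ∀ T ∈ (Finset.univ : Finset (Finset (Fin n))).filter fun T => T.card ≤ s,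
      (1 : ℝ) ≤ (n / k) ^ s * (k / n) ^ T.card := by
    intro T hT
    have hle : T.card ≤ s := (Finset.mem_filter.1 hT).2
    have : ((n : ℝ) / k) ^ T.card * (k / n) ^ T.card = 1 := by
      rw [← mul_pow, div_mul_div_cancel₀ hk'.ne', div_self hn'.ne', one_pow]
    rw [← this]
    gcongr
  have hsum : ∑ T : Finset (Fin n), ((k : ℝ) / n) ^ T.card = (k / n + 1) ^ n := by
    have := Fintype.sum_pow_mul_eq_add_pow (Fin n) ((k : ℝ) / n) 1
    simpa using this
  calc _ = ∑ T ∈ (Finset.univ : Finset (Finset (Fin n))).filter fun T => T.card ≤ s, (1 : ℝ) := by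
        simp
    _ ≤ ∑ T ∈ (Finset.univ : Finset (Finset (Fin n))).filter fun T => T.card ≤ s,
          ((n : ℝ) / k) ^ s * (k / n) ^ T.card := Finset.sum_le_sum hterm
    _ ≤ ∑ T : Finset (Fin n), ((n : ℝ) / k) ^ s * (k / n) ^ T.card :=
        Finset.sum_le_sum_of_subset_of_nonneg (Finset.filter_subset _ _)
          fun _ _ _ => by positivity
    _ = (n / k) ^ s * (k / n + 1) ^ n := by rw [← Finset.mul_sum, hsum]
    _ ≤ (n / k) ^ s * Real.exp (k / n) ^ n := by
        gcongr
        exact Real.add_one_le_exp _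
    _ = Real.exp (s * Real.log (n / k) + k) := by
        rw [Real.exp_add, ← Real.exp_nat_mul, mul_div_cancel₀ _ hn'.ne', Real.exp_nat_mul,
          Real.exp_log (by positivity)]

end Sparse

/-- Theorem `th:lip`, real case: a standard Gaussian random matrix
`A ∈ ℝ^{m×n}` with `m ≥ C·k·log(en/k)` satisfies, with probability at least `1 - exp(-c₀ m)`,
the phaseless bi-Lipschitz condition on `(r+4)k`-sparse vectors with constants `L, U` such that
`√(π/(π-2)) ≤ U/L ≤ √(π/(π-2)) + 0.01`, where `C` depends only on `r`. -/
theorem stmt7 :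
    ∃ c₀ : ℝ, 0 < c₀ ∧
      ∀ r : ℝ, 0 < r →
        ∃ C : ℝ, 0 < C ∧
          ∀ p : ℝ, 0 < p → p ≤ 1 →
            0 < 1 - (Real.sqrt (π / (π - 2)) + 0.01) * 2 ^ (1 / p - 1)
                * (2 / r) ^ (1 / p - 1 / 2) →
            ∀ k n m : ℕ, 0 < k → k ≤ n →
              C * k * Real.log (Real.exp 1 * n / k) ≤ m →
              ENNReal.ofReal (1 - Real.exp (-c₀ * m)) ≤
                gaussMatrixReal m n
                  {A : Fin m → Fin n → ℝ | ∃ L U : ℝ, 0 < L ∧ 0 < U ∧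
                    Real.sqrt (π / (π - 2)) ≤ U / L ∧
                    U / L ≤ Real.sqrt (π / (π - 2)) + 0.01 ∧
                    PhaselessBiLip A {z | (l0Norm z : ℝ) ≤ (r + 4) * k} L U} := by
  obtain ⟨c₁, hc₁, hrate⟩ := exists_uniformBounds_rate
  refine ⟨c₁ / 2, by positivity, fun r hr => ?_⟩
  have hlogK : 0 ≤ Real.log 20001 := Real.log_nonneg (by norm_num)
  set D : ℝ := 2 * (r + 4) * (1 + 2 * Real.log 20001) + 2 with hD
  have hDpos : 0 < D := by positivity
  refine ⟨D / (c₁ / 2), by positivity, fun p _ _ _ k n m hk hkn hm => ?_⟩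
  have hk' : (1 : ℝ) ≤ k := by exact_mod_cast hk
  have hkn' : (k : ℝ) ≤ n := by exact_mod_cast hkn
  have hq : 1 ≤ (n : ℝ) / k := (one_le_div (by linarith)).2 hkn'
  have hlog : Real.log (Real.exp 1 * n / k) = 1 + Real.log (n / k) := by
    rw [mul_div_assoc, Real.log_mul (Real.exp_pos 1).ne' (by linarith), Real.log_exp]
  have hlq : 0 ≤ Real.log (n / k) := Real.log_nonneg hq
  rw [hlog] at hm
  set l : ℝ := Real.log (n / k) with hl
  have hm' : D * (k * (1 + l)) ≤ c₁ / 2 * m := by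
    have := mul_le_mul_of_nonneg_left hm (by positivity : 0 ≤ c₁ / 2)
    have e : c₁ / 2 * (D / (c₁ / 2) * k * (1 + l)) = D * (k * (1 + l)) := by
      field_simp
    linarith
  have hkl : (k : ℝ) ≤ k * (1 + l) := by nlinarith
  have hmpos : 0 < (m : ℝ) := by
    have : 0 < D * (k * (1 + l)) := by positivity
    by_contra h
    have : c₁ / 2 * (m : ℝ) ≤ 0 := mul_nonpos_of_nonneg_of_nonpos (by positivity) (not_lt.1 h)
    linarith
  set s : ℕ := ⌊2 * ((r + 4) * k)⌋₊ with hs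
  have hsle : (s : ℝ) ≤ 2 * ((r + 4) * k) := Nat.floor_le (by positivity)
  set 𝒯 : Finset (Finset (Fin n)) := Finset.univ.filter fun T => T.card ≤ s with h𝒯
  set S : Set (Fin m → Fin n → ℝ) := {A | ∃ L U : ℝ, 0 < L ∧ 0 < U ∧
    √(π / (π - 2)) ≤ U / L ∧ U / L ≤ √(π / (π - 2)) + 0.01 ∧
    PhaselessBiLip A {z | (l0Norm z : ℝ) ≤ (r + 4) * k} L U} with hS
  have hsub : Sᶜ ⊆ ⋃ T ∈ 𝒯, {A | ¬ UniformBounds A T} := by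
    intro A hA
    by_contra hcon
    simp only [Set.mem_iUnion, not_exists, Set.mem_ofPred_eq, not_not] at hcon
    apply hA
    have hκ : 0 ≤ √(π / (π - 2)) := Real.sqrt_nonneg _
    have hsm : 0 < √(m : ℝ) := Real.sqrt_pos.2 hmpos
    have hratio : √(m : ℝ) * 1.001 / (√m * (1.001 / (√(π / (π - 2)) + 0.01)))
        = √(π / (π - 2)) + 0.01 := by
      field_simp
    refine ⟨√m * (1.001 / (√(π / (π - 2)) + 0.01)), √m * 1.001, by positivity, by positivity,
      ?_, hratio.le, phaselessBiLip_of_uniformBounds fun T hT => ?_⟩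
    · rw [hratio]
      linarith
    · exact hcon T (Finset.mem_filter.2 ⟨Finset.mem_univ _, Nat.le_floor hT⟩)
  have hbad : (gaussMatrixReal m n).real Sᶜ ≤ Real.exp (-(c₁ / 2) * m) := by
    calc (gaussMatrixReal m n).real Sᶜ
        ≤ ∑ T ∈ 𝒯, (gaussMatrixReal m n).real {A | ¬ UniformBounds A T} :=
          (measureReal_mono hsub (measure_ne_top _ _)).trans (measureReal_biUnion_finset_le _ _)
      _ ≤ ∑ T ∈ 𝒯, 2 * 20001 ^ (2 * s) * Real.exp (-(c₁ * m)) := by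
          refine Finset.sum_le_sum fun T hT => (hrate m n T).trans ?_
          have : T.card ≤ s := (Finset.mem_filter.1 hT).2
          gcongr
          norm_num
      _ = 𝒯.card * (2 * 20001 ^ (2 * s) * Real.exp (-(c₁ * m))) := by
          rw [Finset.sum_const, nsmul_eq_mul]
      _ ≤ Real.exp (s * l + k) *
          (Real.exp 1 * Real.exp (2 * s * Real.log 20001) * Real.exp (-(c₁ * m))) := by
          have h2 : (2 : ℝ) ≤ Real.exp 1 := by
            have := Real.add_one_le_exp (1 : ℝ)
            linarith
          have h3 : (20001 : ℝ) ^ (2 * s) = Real.exp (2 * s * Real.log 20001) := by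
            rw [← Real.exp_log (show (0 : ℝ) < 20001 by norm_num), ← Real.exp_nat_mul,
              Real.log_exp]
            push_cast
            rfl
          rw [h3]
          gcongr
          exact card_filter_card_le hk hkn
      _ = Real.exp (s * l + k + (1 + 2 * s * Real.log 20001 - c₁ * m)) := by
          rw [← Real.exp_add, ← Real.exp_add, ← Real.exp_add, sub_eq_add_neg]
      _ ≤ Real.exp (-(c₁ / 2) * m) := by
          apply Real.exp_le_exp.2
          have hkey : s * l + k + (1 + 2 * s * Real.log 20001) ≤ D * (k * (1 + l)) := by
            have h1 : s * l ≤ 2 * ((r + 4) * k) * (1 + l) := by gcongr; linarith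
            have h2 : s * Real.log 20001 ≤ 2 * ((r + 4) * (k * (1 + l))) * Real.log 20001 := by
              gcongr
              refine hsle.trans ?_
              gcongr
            rw [hD]
            linarith
          linarith
  have htot : 1 ≤ (gaussMatrixReal m n).real S + (gaussMatrixReal m n).real Sᶜ := by
    have := measureReal_union_le (μ := gaussMatrixReal m n) S Sᶜ
    rwa [Set.union_compl_self, probReal_univ] at this
  apply ENNReal.ofReal_le_of_le_toReal
  change _ ≤ (gaussMatrixReal m n).real S
  linarith
end
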